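/- arXiv:1302.1298 — 4 statements merged into one kernel-verified Lean document; each statement's English description precedes it below -/
import Mathlib

section
/- (Skolem–Mahler–Lech theorem) Let k ≥ 1 and let α_1, …, α_k ∈ ℂ with α_k ≠ 0. Let u : ℕ → ℂ satisfy the linear recurrence u(n) + α_1·u(n−1) + α_2·u(n−2) + ⋯ + α_k·u(n−k) = 0 for all n ≥ k. Then the zero set {n ∈ ℕ : u(n) = 0} is the union of a finite (possibly empty) set and finitely many (possibly zero) infinite arithmetic progressions, i.e. sets of the form {r, r+d, r+2d, …} with d ≥ 1. -/
open Polynomial in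
/-- If the coefficients of `P` of index at least `#s` lie in `I` and `P` vanishes on `s`,
then all values of `P` lie in `I`. -/
theorem Polynomial.eval_mem_of_card_roots {R : Type*} [CommRing R] [IsDomain R] (I : Ideal R)
    (s : Finset R) (P : R[X]) (hs : ∀ a ∈ s, P.eval a = 0)
    (hP : ∀ j, s.card ≤ j → P.coeff j ∈ I) (x : R) : P.eval x ∈ I := by
  classical
  induction s using Finset.induction_on generalizing P with
  | empty =>
    rw [eval_eq_sum, Polynomial.sum]
    exact I.sum_mem fun j _ => I.mul_mem_right _ (hP j (by simp))
  | insert a s ha ih =>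
    obtain ⟨Q, rfl⟩ := dvd_iff_isRoot.2 (hs a (by simp))
    rw [eval_mul]
    refine I.mul_mem_left _ (ih Q (fun b hb => ?_) ?_)
    · have h := hs b (by simp [hb])
      rw [eval_mul, mul_eq_zero] at h
      refine h.resolve_left ?_
      have : b ≠ a := fun h => ha (h ▸ hb)
      simpa [sub_eq_zero] using this
    · have key : ∀ n j, s.card ≤ j → Q.natDegree < j + n → Q.coeff j ∈ I := by
        intro n
        induction n with
        | zero =>
          intro j _ h
          rw [coeff_eq_zero_of_natDegree_lt (by simpa using h)]
          exact I.zero_mem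
        | succ n ihn =>
          intro j hj h
          have h1 := ihn (j + 1) (by omega) (by omega)
          have h2 := hP (j + 1) (by rw [Finset.card_insert_of_notMem ha]; omega)
          have h3 : Q.coeff j = ((X - C a) * Q).coeff (j + 1) + a * Q.coeff (j + 1) := by
            rw [sub_mul, coeff_sub, coeff_X_mul, coeff_C_mul]; ring
          rw [h3]
          exact I.add_mem h2 (I.mul_mem_left _ h1)
      exact fun j hj => key (Q.natDegree + 1) j hj (by omega)

/-- For odd `p`, the quotient `p ^ i / i!` is a `p`-adic integer divisible by `p ^ (i - i / 2)`. -/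
theorem PadicInt.exists_factorial_mul_eq_pow {p : ℕ} [Fact p.Prime] (hp : 3 ≤ p) (i : ℕ) :
    ∃ q : ℤ_[p], (i.factorial : ℤ_[p]) * q = (p : ℤ_[p]) ^ i ∧ (p : ℤ_[p]) ^ (i - i / 2) ∣ q := by
  have hv : 2 * padicValNat p i.factorial ≤ i := by
    have h := sub_one_mul_padicValNat_factorial (p := p) i
    have : 2 * padicValNat p i.factorial ≤ (p - 1) * padicValNat p i.factorial :=
      Nat.mul_le_mul_right _ (by omega)
    omega
  obtain ⟨m, hm⟩ := pow_padicValNat_dvd (p := p) (n := i.factorial)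
  have hpm : ¬ p ∣ m := fun ⟨c, hc⟩ => by
    refine pow_succ_padicValNat_not_dvd (p := p) i.factorial_ne_zero ⟨c, ?_⟩
    rw [pow_succ, mul_assoc, ← hc, ← hm]
  set v := padicValNat p i.factorial
  have hu : IsUnit (m : ℤ_[p]) := by
    rw [PadicInt.isUnit_iff, PadicInt.norm_natCast_eq_one_iff]
    exact (Nat.Prime.coprime_iff_not_dvd Fact.out).2 hpm
  obtain ⟨w, hw⟩ := hu.exists_right_inv
  refine ⟨(p : ℤ_[p]) ^ (i - v) * w, ?_, ?_⟩
  · rw [hm]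
    push_cast
    rw [mul_mul_mul_comm, hw, mul_one, ← pow_add]
    congr 1
    omega
  · exact (pow_dvd_pow _ (by omega)).mul_right _

open Polynomial in
/-- A function on `ℕ` with Mahler coefficients `p ^ i * c i` and infinitely many zeros is zero. -/
theorem PadicInt.eq_zero_of_infinite_zeros {p : ℕ} [Fact p.Prime] (hp : 3 ≤ p) (f c : ℕ → ℤ_[p])
    (hf : ∀ n, f n = ∑ i ∈ Finset.range (n + 1), (n.choose i : ℤ_[p]) * (p : ℤ_[p]) ^ i * c i)
    (hinf : {n | f n = 0}.Infinite) (n : ℕ) : f n = 0 := by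
  choose q hq hqd using PadicInt.exists_factorial_mul_eq_pow (p := p) hp
  let R : ℕ → ℤ_[p][X] := fun m =>
    ∑ i ∈ Finset.range (m + 1), C (c i * q i) * descPochhammer ℤ_[p] i
  have hR : ∀ m t, t ≤ m → (R m).eval (t : ℤ_[p]) = f t := by
    intro m t htm
    rw [hf, eval_finsetSum]
    symm
    refine Finset.sum_subset_zero_on_sdiff (Finset.range_mono (by omega)) ?_ ?_
    · intro i hi
      have : t.descFactorial i = 0 := Nat.descFactorial_eq_zero_iff_lt.2 (by simp at hi; omega)
      simp [descPochhammer_eval_eq_descFactorial, this]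
    · intro i _
      rw [eval_mul, eval_C, descPochhammer_eval_eq_descFactorial,
        Nat.descFactorial_eq_factorial_mul_choose, ← hq]
      push_cast
      ring
  have hdiv : ∀ k, (p : ℤ_[p]) ^ (k - k / 2) ∣ f n := by
    intro k
    obtain ⟨s, hs, hcard⟩ := hinf.exists_subset_card_eq k
    obtain ⟨m, hm⟩ : ∃ m, ∀ t ∈ insert n s, t ≤ m := ⟨(insert n s).sup id, fun t ht =>
      Finset.le_sup (f := id) ht⟩
    rw [← hR m n (hm n (by simp)), ← Ideal.mem_span_singleton]
    refine eval_mem_of_card_roots _ (s.map Nat.castEmbedding) _ ?_ ?_ _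
    · intro a ha
      obtain ⟨t, ht, rfl⟩ := Finset.mem_map.1 ha
      rw [Nat.castEmbedding_apply, hR m t (hm t (by simp [ht]))]
      exact hs ht
    · intro j hj
      rw [Finset.card_map, hcard] at hj
      rw [finsetSum_coeff]
      refine Ideal.sum_mem _ fun i _ => ?_
      rw [coeff_C_mul, Ideal.mem_span_singleton]
      rcases lt_or_ge i j with h | h
      · rw [coeff_eq_zero_of_natDegree_lt (by rwa [descPochhammer_natDegree]), mul_zero]
        exact dvd_zero _
      · exact (((pow_dvd_pow _ (by omega)).trans (hqd i)).mul_left _).mul_right _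
  by_contra hne
  refine hne ?_
  have hfin : FiniteMultiplicity (p : ℤ_[p]) (f n) :=
    FiniteMultiplicity.of_prime_left PadicInt.prime_p hne
  obtain ⟨N, hN⟩ := hfin
  exact absurd ((pow_dvd_pow _ (by omega)).trans (hdiv (2 * N + 2))) hN

/-- Some positive power of a unit in a finite `ℤ_[p]`-algebra is congruent to `1` modulo `p`. -/
theorem PadicInt.exists_pow_eq_one_add {p : ℕ} [Fact p.Prime] {A : Type*} [Ring A]
    [Algebra ℤ_[p] A] [Module.Finite ℤ_[p] A] (x : Aˣ) :
    ∃ d, 0 < d ∧ ∃ y : A, (x : A) ^ d = 1 + (p : ℤ_[p]) • y := by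
  let N : Submodule ℤ_[p] A := Ideal.span {(p : ℤ_[p])} • ⊤
  have : Finite (ℤ_[p] ⧸ Ideal.span {(p : ℤ_[p])}) := by
    rw [← PadicInt.maximalIdeal_eq_span_p]
    have : NeZero p := ⟨(Fact.out : p.Prime).ne_zero⟩
    exact .of_equiv _ (PadicInt.residueField (p := p)).symm.toEquiv
  have : Finite (A ⧸ (⊤ : Submodule ℤ_[p] A)) := inferInstance
  have : Finite (A ⧸ N) := Submodule.finite_quotient_smul _ Module.Finite.fg_top
  obtain ⟨i, j, hne, h⟩ := Finite.exists_ne_map_eq_of_infinite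
    fun n : ℕ => N.mkQ ((x : A) ^ n)
  wlog hij : i < j generalizing i j
  · exact this j i hne.symm h.symm (by omega)
  have h' := (Submodule.Quotient.eq N).1 h.symm
  simp only [N] at h'
  rw [Submodule.ideal_span_singleton_smul, Submodule.mem_smul_pointwise_iff_exists] at h'
  obtain ⟨z, -, hz⟩ := h'
  refine ⟨j - i, by omega, ((x ^ i)⁻¹ : Aˣ) * z, ?_⟩
  have hp : (x : A) ^ j = (x ^ i : Aˣ) * (x : A) ^ (j - i) := by
    rw [Units.val_pow_eq_pow_val, ← pow_add]
    congr 1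
    omega
  rw [← mul_smul_comm, hz, mul_sub, hp, Units.inv_mul_cancel_left, ← Units.val_pow_eq_pow_val x i,
    Units.inv_mul]
  abel

/-- For an automorphism `T` of a finite free `ℤ_[p]`-module, the sequence `l (T ^ n w)` restricted
to each residue class modulo some `d` either has finitely many zeros or vanishes identically. -/
theorem PadicInt.exists_forall_apply_pow_eq_zero {p : ℕ} [Fact p.Prime] (hp : 3 ≤ p)
    {V : Type*} [AddCommGroup V] [Module ℤ_[p] V] [Module.Finite ℤ_[p] V] [Module.Free ℤ_[p] V]
    (T : (Module.End ℤ_[p] V)ˣ) :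
    ∃ d, 0 < d ∧ ∀ (l : V →ₗ[ℤ_[p]] ℤ_[p]) (w : V),
      {n : ℕ | l (((T : Module.End ℤ_[p] V) ^ (d * n)) w) = 0}.Infinite →
      ∀ n, l (((T : Module.End ℤ_[p] V) ^ (d * n)) w) = 0 := by
  obtain ⟨d, hd, y, hy⟩ := PadicInt.exists_pow_eq_one_add (p := p) T
  refine ⟨d, hd, fun l w hinf => PadicInt.eq_zero_of_infinite_zeros hp
    (fun n => l (((T : Module.End ℤ_[p] V) ^ (d * n)) w)) (fun i => l ((y ^ i) w)) ?_ hinf⟩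
  intro n
  rw [pow_mul, hy, add_comm, (Commute.one_right _).add_pow, LinearMap.sum_apply, map_sum]
  refine Finset.sum_congr rfl fun i _ => ?_
  rw [one_pow, mul_one, smul_pow, ← Nat.cast_comm, ← nsmul_eq_mul, LinearMap.smul_apply,
    LinearMap.smul_apply, map_nsmul, map_smul, nsmul_eq_mul, smul_eq_mul, mul_assoc]

theorem LinearRecurrence.tupleSucc_surjective {R : Type*} [CommRing R] (E : LinearRecurrence R)
    (hE : 0 < E.order) (hu : IsUnit (E.coeffs ⟨0, hE⟩)) : Function.Surjective E.tupleSucc := by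
  obtain ⟨m, a⟩ := E
  obtain _ | m := m
  · exact absurd hE (lt_irrefl 0)
  obtain ⟨c, hc⟩ := hu.exists_right_inv
  intro w
  dsimp only at w a hc
  let x : R := c * (w (Fin.last m) - ∑ i : Fin m, a i.succ * w i.castSucc)
  have hx : a 0 * x = w (Fin.last m) - ∑ i : Fin m, a i.succ * w i.castSucc := by
    change a 0 * (c * _) = _
    rw [← mul_assoc]
    erw [hc]
    rw [one_mul]
  refine ⟨(Fin.cons x (fun i : Fin m => w i.castSucc) : Fin (m + 1) → R), ?_⟩
  funext i
  simp only [LinearRecurrence.tupleSucc, LinearMap.coe_mk, AddHom.coe_mk]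
  refine Fin.lastCases ?_ (fun i => ?_) i
  · rw [dif_neg (by simp), Fin.sum_univ_succ]
    simp [hx]
  · rw [dif_pos (by simp)]
    exact Fin.cons_succ (α := fun _ => R) x (fun i : Fin m => w i.castSucc) i

/-- Zeros of linear recurrent sequences over a finite free `ℤ_[p]`-algebra, when the last
coefficient of the recurrence is a unit. -/
theorem LinearRecurrence.exists_forall_eq_zero {p : ℕ} [Fact p.Prime] (hp : 3 ≤ p)
    {S : Type*} [CommRing S] [Algebra ℤ_[p] S] [Module.Finite ℤ_[p] S] [Module.Free ℤ_[p] S]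
    (E : LinearRecurrence S) (hE : 0 < E.order) (hu : IsUnit (E.coeffs ⟨0, hE⟩)) (v : ℕ → S)
    (hv : E.IsSolution v) :
    ∃ d, 0 < d ∧ ∀ r, {n : ℕ | v (r + d * n) = 0}.Infinite → ∀ n, v (r + d * n) = 0 := by
  have hsucc : ∀ n, E.tupleSucc (fun i => v (n + i)) = fun i : Fin E.order => v (n + 1 + i) := by
    intro n
    funext i
    simp only [LinearRecurrence.tupleSucc, LinearMap.coe_mk, AddHom.coe_mk]
    split_ifs with h
    · congr 1
      omega
    · rw [← hv n]
      congr 1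
      omega
  have hpow : ∀ n r, (E.tupleSucc ^ n) (fun i => v (r + i)) =
      fun i : Fin E.order => v (r + n + i) := by
    intro n
    induction n with
    | zero => intro r; simp
    | succ n ih =>
      intro r
      rw [pow_succ, Module.End.mul_apply, hsucc, ih]
      simp only [add_assoc, add_comm n 1]
  have hsurj : Function.Surjective (E.tupleSucc.restrictScalars ℤ_[p]) :=
    E.tupleSucc_surjective hE hu
  have hunit : IsUnit (E.tupleSucc.restrictScalars ℤ_[p]) :=
    (Module.End.isUnit_iff _).2
      ⟨OrzechProperty.injective_of_surjective_endomorphism _ hsurj, hsurj⟩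
  obtain ⟨T, hT⟩ := hunit
  have hTpow : ∀ n r, ((T : Module.End ℤ_[p] (Fin E.order → S)) ^ n) (fun i => v (r + i)) =
      fun i : Fin E.order => v (r + n + i) := by
    intro n r
    rw [← hpow, hT, Module.End.pow_apply, Module.End.pow_apply]
    rfl
  obtain ⟨d, hd, h⟩ := PadicInt.exists_forall_apply_pow_eq_zero hp T
  refine ⟨d, hd, fun r hinf n => ?_⟩
  let b := Module.Free.chooseBasis ℤ_[p] S
  refine b.ext_elem fun i => ?_
  have h1 := h (b.coord i ∘ₗ LinearMap.proj ⟨0, hE⟩) (fun i => v (r + i))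
  simp only [hTpow, LinearMap.comp_apply, LinearMap.proj_apply, Module.Basis.coord_apply,
    add_zero] at h1
  rw [h1 (hinf.mono fun m hm => ?_) n]
  · simp
  · rw [Set.mem_ofPred_eq] at hm ⊢
    simp [hm]

/-- For every `s` there are `s` algebraically independent `p`-adic integers. -/
theorem PadicInt.exists_algebraicIndependent (p : ℕ) [Fact p.Prime] (s : ℕ) :
    ∃ t : Fin s → ℤ_[p], AlgebraicIndependent ℚ fun i => (t i : ℚ_[p]) := by
  have hunc : Cardinal.aleph0 < Cardinal.mk ℤ_[p] :=
    Cardinal.aleph0_lt_continuum.trans_le <|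
      (continuum_le_cardinal_of_nontriviallyNormedField ℚ_[p]).trans
        (IsLocalization.cardinalMk_le (nonZeroDivisors ℤ_[p]))
  obtain ⟨B, hB⟩ := exists_isTranscendenceBasis ℤ ℤ_[p]
  have hBinf : Infinite B := by
    by_contra hfin
    rw [not_infinite_iff_finite] at hfin
    have := hB.isAlgebraic
    have hle := Algebra.IsAlgebraic.cardinalMk_le_max
      (Algebra.adjoin ℤ (Set.range ((↑) : B → ℤ_[p]))) ℤ_[p]
    rw [← Cardinal.mk_congr hB.1.aevalEquiv.toEquiv] at hle
    refine hunc.not_ge (hle.trans (max_le (MvPolynomial.cardinalMk_le_max.trans ?_) le_rfl))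
    simp
  let e : Fin s ↪ B := Fin.valEmbedding.trans (Infinite.natEmbedding B)
  refine ⟨fun i => e i, ?_⟩
  have h : AlgebraicIndependent ℤ fun i => ((e i : ℤ_[p]) : ℚ_[p]) :=
    (hB.1.comp e e.injective).map' (f := (Algebra.ofId ℤ_[p] ℚ_[p]).restrictScalars ℤ)
      (IsFractionRing.injective ℤ_[p] ℚ_[p])
  have : Algebra.IsAlgebraic ℤ ℚ := IsLocalization.isAlgebraic _ (nonZeroDivisors ℤ)
  exact h.extendScalars ℚ

theorem MvPolynomial.isIntegral_aeval_padicInt {p : ℕ} [Fact p.Prime] {σ : Type*}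
    (t : σ → ℤ_[p]) (f : MvPolynomial σ ℚ) (hf : ∀ m ∈ f.support, ¬ p ∣ (f.coeff m).den) :
    IsIntegral ℤ_[p] (aeval (fun i => (t i : ℚ_[p])) f) := by
  rw [aeval_def, eval₂_eq]
  refine IsIntegral.sum _ fun m hm => IsIntegral.mul ?_ (IsIntegral.prod _ fun i _ => ?_)
  · let c : ℤ_[p] := ⟨((f.coeff m : ℚ) : ℚ_[p]), Padic.norm_rat_le_one (hf m hm)⟩
    exact isIntegral_algebraMap (x := c)
  · exact (isIntegral_algebraMap (x := t i)).pow _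

theorem IsAlgClosed.exists_injective_comp_eq {R A M : Type*} [CommRing R] [IsDomain R] [CommRing A]
    [IsDomain A] [Field M] [IsAlgClosed M] (g : R →+* A) (hg : Function.Injective g)
    (hgi : g.IsIntegral) (f : R →+* M) (hf : Function.Injective f) :
    ∃ φ : A →+* M, Function.Injective φ ∧ φ.comp g = f := by
  algebraize [g, f]
  have := Module.isTorsionFree_iff_algebraMap_injective.2 hg
  have := Module.isTorsionFree_iff_algebraMap_injective.2 hf
  let φ : A →ₐ[R] M := IsAlgClosed.lift
  refine ⟨φ, ?_, φ.comp_algebraMap⟩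
  rw [RingHom.injective_iff_ker_eq_bot]
  refine Ideal.eq_bot_of_comap_eq_bot (R := R) ?_
  rw [RingHom.comap_ker, φ.comp_algebraMap, ← RingHom.injective_iff_ker_eq_bot]
  exact hf

open Filter in
theorem MvPolynomial.eventually_forall_not_dvd_den {σ : Type*} (f : MvPolynomial σ ℚ) :
    ∀ᶠ p in atTop, ∀ m ∈ f.support, ¬ p ∣ (f.coeff m).den :=
  (eventually_all_finset _).2 fun m _ => (eventually_gt_atTop (f.coeff m).den).mono
    fun _ hp h => (Nat.le_of_dvd (f.coeff m).pos h).not_gt hp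

/-- A finitely generated ring that embeds into a field over `ℤ_[p]` with integral generators embeds
into a finite free `ℤ_[p]`-algebra. -/
theorem PadicInt.exists_injective_of_isIntegral {p : ℕ} [Fact p.Prime] {K : Type*} [Field K]
    [Algebra ℤ_[p] K] (hinj : Function.Injective (algebraMap ℤ_[p] K)) {B : Type*} [CommRing B]
    (φ : B →+* K) (hφ : Function.Injective φ) {G : Set B} (hG : G.Finite)
    (hadj : Algebra.adjoin ℤ G = ⊤) (hint : ∀ x ∈ G, IsIntegral ℤ_[p] (φ x)) :
    ∃ (S : Subalgebra ℤ_[p] K) (ψ : B →+* S), Module.Finite ℤ_[p] S ∧ Module.Free ℤ_[p] S ∧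
      Function.Injective ψ := by
  let S := Algebra.adjoin ℤ_[p] (φ '' G)
  have hfin : Module.Finite ℤ_[p] S :=
    Module.Finite.iff_fg.2 (fg_adjoin_of_finite (hG.image φ) (Set.forall_mem_image.2 hint))
  have : Module.IsTorsionFree ℤ_[p] S :=
    Module.isTorsionFree_iff_algebraMap_injective.2 fun _ _ h =>
      hinj (congrArg Subtype.val h)
  have hmem : ∀ x, φ x ∈ S := fun x => by
    have hx : x ∈ Algebra.adjoin ℤ G := hadj ▸ Algebra.mem_top
    induction hx using Algebra.adjoin_induction with
    | mem x hx => exact Algebra.subset_adjoin ⟨_, hx, rfl⟩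
    | algebraMap r => simp
    | add x y _ _ h1 h2 => exact map_add φ x y ▸ S.add_mem h1 h2
    | mul x y _ _ h1 h2 => exact map_mul φ x y ▸ S.mul_mem h1 h2
  exact ⟨S, φ.codRestrict S hmem, hfin, Module.free_of_finite_type_torsion_free',
    fun x y hxy => hφ (congrArg Subtype.val hxy)⟩

theorem Polynomial.Monic.isIntegral_of_eval₂_eq_zero {R B K : Type*} [CommRing R] [CommRing B]
    [Field K] [Algebra R K] {P : Polynomial B} (hP : P.Monic) (f : B →+* K) {y : K}
    (hy : P.eval₂ f y = 0) (hc : ∀ c ∈ P.coeffs, IsIntegral R (f c)) : IsIntegral R y := by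
  rw [← eval_map] at hy
  refine IsIntegral.of_aeval_monic_of_isIntegral_coeff (hP.map f) ?_ ?_ fun i => ?_
  · intro h0
    rw [(hP.map f).natDegree_eq_zero.1 h0] at hy
    simp at hy
  · rw [hy]
    exact isIntegral_zero
  · rw [coeff_map]
    by_cases hi : P.coeff i = 0
    · rw [hi, map_zero]
      exact isIntegral_zero
    · exact hc _ (coeff_mem_coeffs hi)

open Filter in
/-- A finitely generated `ℚ`-algebra that is a domain embeds, for some prime `p ≥ 3`, into an
algebraic closure of `ℚ_[p]` so that a given finite set consists of `p`-adically integral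
elements. -/
theorem PadicInt.exists_injective_isIntegral (A : Type*) [CommRing A] [IsDomain A] [Algebra ℚ A]
    [Algebra.FiniteType ℚ A] {G : Set A} (hG : G.Finite) :
    ∃ (p : ℕ) (_ : Fact p.Prime) (φ : A →+* AlgebraicClosure ℚ_[p]), 3 ≤ p ∧
      Function.Injective φ ∧ ∀ x ∈ G, IsIntegral ℤ_[p] (φ x) := by
  obtain ⟨s, g, hinj, hint⟩ := exists_integral_inj_algHom_of_fg ℚ A
  choose P hPm hP using hint
  have hev : ∀ᶠ p in atTop, ∀ x ∈ G, ∀ f ∈ (P x).coeffs, ∀ m ∈ f.support,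
      ¬ p ∣ (f.coeff m).den :=
    (eventually_all_finite hG).2 fun x _ => (eventually_all_finset _).2 fun f _ =>
      f.eventually_forall_not_dvd_den
  obtain ⟨N, hN⟩ := eventually_atTop.1 hev
  obtain ⟨p, hpN, hp⟩ := Nat.exists_infinite_primes (max N 3)
  have : Fact p.Prime := ⟨hp⟩
  obtain ⟨t, ht⟩ := PadicInt.exists_algebraicIndependent p s
  let f : MvPolynomial (Fin s) ℚ →+* AlgebraicClosure ℚ_[p] :=
    (algebraMap ℚ_[p] _).comp (MvPolynomial.aeval (fun i => (t i : ℚ_[p]))).toRingHom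
  obtain ⟨φ, hφ, hφg⟩ := IsAlgClosed.exists_injective_comp_eq (g : _ →+* A) hinj
    (fun x => ⟨P x, hPm x, hP x⟩) f ((algebraMap ℚ_[p] _).injective.comp ht)
  refine ⟨p, ‹_›, φ, le_of_max_le_right hpN, hφ, fun x hx =>
    (hPm x).isIntegral_of_eval₂_eq_zero f ?_ fun c hc => ?_⟩
  · rw [← hφg, ← Polynomial.hom_eval₂]
    exact (congrArg φ (hP x)).trans (map_zero φ)
  · exact (MvPolynomial.isIntegral_aeval_padicInt t _
      (hN p (le_of_max_le_left hpN) x hx c hc)).algebraMap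

theorem Algebra.exists_adjoin_int_ringHom {L : Type*} [Field L] [CharZero L] {G : Set L}
    (A : Subalgebra ℚ L) (hG : ∀ x ∈ G, x ∈ A) :
    ∃ ι : Algebra.adjoin ℤ G →+* A, ∀ x, (ι x : L) = x := by
  have hle : Algebra.adjoin ℤ G ≤ A.restrictScalars ℤ := Algebra.adjoin_le hG
  generalize Algebra.adjoin ℤ G = B at hle
  exact ⟨B.val.toRingHom.codRestrict A fun x => hle x.2, fun _ => rfl⟩

/-- A finite subset of a field of characteristic zero is contained, up to a ring embedding,
in a finite free `ℤ_[p]`-algebra for some prime `p ≥ 3`. -/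
theorem PadicInt.exists_injective_adjoin {L : Type*} [Field L] [CharZero L] {G : Set L}
    (hG : G.Finite) :
    ∃ (p : ℕ) (_ : Fact p.Prime) (S : Type) (_ : CommRing S) (_ : Algebra ℤ_[p] S)
      (φ : Algebra.adjoin ℤ G →+* S), 3 ≤ p ∧ Module.Finite ℤ_[p] S ∧ Module.Free ℤ_[p] S ∧
      Function.Injective φ := by
  let A := Algebra.adjoin ℚ G
  have : Algebra.FiniteType ℚ A := (Subalgebra.fg_iff_finiteType _).1 ⟨hG.toFinset, by simp [A]⟩
  have hG' : {x : A | (x : L) ∈ G}.Finite := hG.preimage Subtype.val_injective.injOn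
  obtain ⟨p, _, φ, hp, hφ, hint⟩ := PadicInt.exists_injective_isIntegral A hG'
  obtain ⟨ι, hι⟩ := Algebra.exists_adjoin_int_ringHom A fun x hx => Algebra.subset_adjoin hx
  have hιinj : Function.Injective ι := fun x y h => Subtype.ext (by rw [← hι, ← hι, h])
  have hZ : Function.Injective (algebraMap ℤ_[p] (AlgebraicClosure ℚ_[p])) := by
    rw [IsScalarTower.algebraMap_eq ℤ_[p] ℚ_[p] (AlgebraicClosure ℚ_[p])]
    exact (algebraMap ℚ_[p] _).injective.comp (IsFractionRing.injective ℤ_[p] ℚ_[p])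
  obtain ⟨S, ψ, hfin, hfree, hψ⟩ := PadicInt.exists_injective_of_isIntegral hZ (φ.comp ι)
    (hφ.comp hιinj) (hG.preimage Subtype.val_injective.injOn)
    Algebra.adjoin_adjoin_coe_preimage fun x hx => hint (ι x) <| by
      rwa [Set.mem_ofPred_eq, hι]
  exact ⟨p, inferInstance, S, inferInstance, inferInstance, ψ, hp, hfin, hfree, hψ⟩

theorem Nat.exists_eq_finset_union_progressions (Z : Set ℕ) {d : ℕ} (hd : 0 < d)
    (h : ∀ r, {n | r + d * n ∈ Z}.Infinite → ∀ n, r + d * n ∈ Z) :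
    ∃ (F : Finset ℕ) (P : Finset (ℕ × ℕ)), (∀ p ∈ P, 1 ≤ p.2) ∧
      Z = ↑F ∪ ⋃ p ∈ P, {n : ℕ | ∃ j : ℕ, n = p.1 + j * p.2} := by
  classical
  let T : Finset ℕ := {r ∈ Finset.range d | ∀ n, r + d * n ∈ Z}
  have hfin : {m | m ∈ Z ∧ m % d ∉ T}.Finite := by
    refine (Set.Finite.biUnion ((Finset.range d) \ T).finite_toSet
      (t := fun r => (fun n => r + d * n) '' {n | r + d * n ∈ Z}) fun r hr => ?_).subset ?_
    · rw [Finset.mem_coe, Finset.mem_sdiff] at hr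
      refine (Set.not_infinite.1 fun hinf => hr.2 ?_).image _
      exact Finset.mem_filter.2 ⟨hr.1, h r hinf⟩
    · rintro m ⟨hm, hmT⟩
      have hdiv : m % d + d * (m / d) = m := Nat.mod_add_div m d
      refine Set.mem_biUnion (x := m % d) ?_ ⟨m / d, ?_, hdiv⟩
      · simpa [hmT] using Nat.mod_lt m hd
      · rwa [Set.mem_ofPred_eq, hdiv]
  refine ⟨hfin.toFinset, T.image fun r => (r, d), ?_, ?_⟩
  · intro p hp
    obtain ⟨r, -, rfl⟩ := Finset.mem_image.1 hp
    exact hd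
  · ext m
    simp only [Set.Finite.coe_toFinset, Set.mem_union, Set.mem_ofPred_eq, Set.mem_iUnion,
      Finset.mem_image, exists_prop]
    constructor
    · intro hm
      by_cases hT : m % d ∈ T
      · exact Or.inr ⟨_, ⟨_, hT, rfl⟩, m / d, (Nat.mod_add_div' m d).symm⟩
      · exact Or.inl ⟨hm, hT⟩
    · rintro (hm | ⟨_, ⟨r, hr, rfl⟩, j, rfl⟩)
      · exact hm.1
      · rw [mul_comm]
        exact (Finset.mem_filter.1 hr).2 j

/-- **The Skolem–Mahler–Lech theorem.** If `u : ℕ → ℂ` satisfies a linear recurrence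
relation `u n + α₁ u (n-1) + ⋯ + α_k u (n-k) = 0` (for `n ≥ k`) of order `k` with
constant coefficients `α₁, …, α_k ∈ ℂ`, `α_k ≠ 0`, then the set `{n | u n = 0}` is the
union of a finite set and finitely many infinite arithmetic progressions
`{r, r+d, r+2d, …}` with `d ≥ 1`. -/
theorem skolem_mahler_lech (k : ℕ) (hk : 1 ≤ k) (α : Fin k → ℂ)
    (hαk : α ⟨k - 1, by omega⟩ ≠ 0) (u : ℕ → ℂ)
    (hrec : ∀ n, k ≤ n → u n + ∑ j : Fin k, α j * u (n - ((j : ℕ) + 1)) = 0) :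
    ∃ (F : Finset ℕ) (P : Finset (ℕ × ℕ)), (∀ p ∈ P, 1 ≤ p.2) ∧
      {n : ℕ | u n = 0} = ↑F ∪ ⋃ p ∈ P, {n : ℕ | ∃ j : ℕ, n = p.1 + j * p.2} := by
  let G : Set ℂ := Set.range α ∪ {(α ⟨k - 1, by omega⟩)⁻¹} ∪ u '' Set.Iio k
  have hG : G.Finite := ((Set.finite_range α).union (Set.finite_singleton _)).union
    ((Set.finite_Iio k).image u)
  obtain ⟨p, _, S, _, _, φ, hp, _, _, hφ⟩ := PadicInt.exists_injective_adjoin hG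
  have hα : ∀ j, α j ∈ Algebra.adjoin ℤ G := fun j =>
    Algebra.subset_adjoin (Or.inl (Or.inl ⟨j, rfl⟩))
  have hinv : (α ⟨k - 1, by omega⟩)⁻¹ ∈ Algebra.adjoin ℤ G :=
    Algebra.subset_adjoin (Or.inl (Or.inr rfl))
  have hu : ∀ n, u n ∈ Algebra.adjoin ℤ G := by
    intro n
    induction n using Nat.strong_induction_on with
    | _ n ih =>
      rcases lt_or_ge n k with hn | hn
      · exact Algebra.subset_adjoin (Or.inr ⟨n, hn, rfl⟩)
      · rw [eq_neg_of_add_eq_zero_left (hrec n hn)]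
        exact neg_mem (sum_mem fun j _ => mul_mem (hα j) (ih _ (by omega)))
  let a : Fin k → Algebra.adjoin ℤ G := fun j => ⟨α j, hα j⟩
  let v : ℕ → Algebra.adjoin ℤ G := fun n => ⟨u n, hu n⟩
  have hv : ∀ n, v (n + k) = ∑ i : Fin k, -a i.rev * v (n + i) := by
    intro n
    refine Subtype.ext ?_
    rw [AddSubmonoidClass.coe_finsetSum]
    change u (n + k) = ∑ i : Fin k, -α i.rev * u (n + i)
    rw [eq_neg_of_add_eq_zero_left (hrec (n + k) (by omega)), ← Finset.sum_neg_distrib,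
      ← Equiv.sum_comp Fin.revPerm]
    refine Finset.sum_congr rfl fun i _ => ?_
    rw [Fin.revPerm_apply, neg_mul, Fin.val_rev]
    congr 3
    omega
  let E : LinearRecurrence S := ⟨k, fun i => φ (-a i.rev)⟩
  have hunit : IsUnit (E.coeffs ⟨0, hk⟩) := by
    refine (IsUnit.of_mul_eq_one ⟨_, hinv⟩ (Subtype.ext ?_)).neg.map φ
    have hrev : (⟨0, hk⟩ : Fin k).rev = ⟨k - 1, by omega⟩ := Fin.ext (by simp)
    change α (Fin.rev ⟨0, hk⟩) * _ = 1
    rw [hrev]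
    exact mul_inv_cancel₀ hαk
  have hsol : E.IsSolution fun n => φ (v n) := fun n => by
    change φ (v (n + k)) = ∑ i : Fin k, φ (-a i.rev) * φ (v (n + i))
    rw [hv, map_sum]
    simp only [map_mul]
  obtain ⟨d, hd, h⟩ := E.exists_forall_eq_zero hp hk hunit _ hsol
  have hzero : ∀ n, φ (v n) = 0 ↔ u n = 0 := fun n => by
    rw [map_eq_zero_iff φ hφ]
    exact Subtype.ext_iff
  simp only [hzero] at h
  exact Nat.exists_eq_finset_union_progressions {n | u n = 0} hd h
end

section
/- Let λ_1, …, λ_n ∈ ℂ have pairwise distinct real parts (Re λ_i ≠ Re λ_j for i ≠ j), and let c_1, …, c_n ∈ ℂ be not all zero. Then the set of real zeros {x ∈ ℝ : c_1·e^{λ_1 x} + c_2·e^{λ_2 x} + ⋯ + c_n·e^{λ_n x} = 0} is finite. -/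
open Filter Topology in
/-- An exponential polynomial whose exponents have distinct real parts is dominated at `+∞` by the
term with the largest real part, so it does not vanish there. -/
theorem eventually_atTop_sum_mul_cexp_ne_zero {ι : Type*} [Fintype ι] {lam c : ι → ℂ}
    (hre : ∀ i j, i ≠ j → (lam i).re ≠ (lam j).re) (hc : c ≠ 0) :
    ∀ᶠ x : ℝ in atTop, ∑ i, c i * Complex.exp (lam i * (x : ℂ)) ≠ 0 := by
  classical
  obtain ⟨k, hk⟩ := Function.ne_iff.mp hc
  obtain ⟨m, hm, hmax⟩ := (Finset.univ.filter fun i ↦ c i ≠ 0).exists_max_image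
    (fun i ↦ (lam i).re) ⟨k, by simpa using hk⟩
  simp only [Finset.mem_filter, Finset.mem_univ, true_and] at hm hmax
  have hterm (i : ι) : Tendsto (fun x : ℝ ↦ c i * Complex.exp ((lam i - lam m) * (x : ℂ))) atTop
      (𝓝 (if i = m then c m else 0)) := by
    split_ifs with him
    · simp [him]
    by_cases hci : c i = 0
    · simp [hci]
    have hneg : (lam i - lam m).re < 0 := by
      simpa using lt_of_le_of_ne (hmax i hci) (hre i m him)
    rw [← mul_zero (c i)]
    refine (Complex.tendsto_exp_comap_re_atBot.comp (tendsto_comap_iff.mpr ?_)).const_mul (c i)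
    simpa [Function.comp_def] using tendsto_id.const_mul_atTop_of_neg hneg
  have hlim := tendsto_finsetSum Finset.univ fun i _ ↦ hterm i
  rw [Finset.sum_ite_eq' Finset.univ m, if_pos (Finset.mem_univ m)] at hlim
  filter_upwards [hlim.eventually_ne hm] with x hx hzero
  refine hx ?_
  have hfactor : ∑ i, c i * Complex.exp ((lam i - lam m) * (x : ℂ)) =
      (∑ i, c i * Complex.exp (lam i * (x : ℂ))) * Complex.exp (-(lam m * (x : ℂ))) := by
    rw [Finset.sum_mul]
    refine Finset.sum_congr rfl fun i _ ↦ ?_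
    rw [mul_assoc, ← Complex.exp_add]
    ring_nf
  rw [hfactor, hzero, zero_mul]

open Filter Topology in
/-- A real-analytic function that does not vanish near infinity has finitely many zeros. -/
theorem AnalyticOnNhd.finite_zeros_of_eventually_cocompact_ne_zero {E : Type*}
    [NormedAddCommGroup E] [NormedSpace ℝ E] {f : ℝ → E} (hf : AnalyticOnNhd ℝ f Set.univ)
    (hne : ∀ᶠ x in cocompact ℝ, f x ≠ 0) : {x | f x = 0}.Finite := by
  obtain ⟨K, hK, hKf⟩ := mem_cocompact.mp hne
  by_contra hinf
  have hsub : {x | f x = 0} ⊆ K := fun x hx ↦ by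
    by_contra hxK
    exact hKf hxK hx
  obtain ⟨x, -, hacc⟩ := Set.Infinite.exists_accPt_of_subset_isCompact hinf hK hsub
  have hzero : f = 0 := hf.eq_of_frequently_eq analyticOnNhd_const
    (accPt_iff_frequently_nhdsNE.mp hacc)
  obtain ⟨y, hy⟩ := hne.exists
  exact hy (congrFun hzero y)

/-- If `λ₁, …, λ_n ∈ ℂ` have pairwise distinct real parts and `c₁, …, c_n ∈ ℂ` are not
all zero, then the exponential polynomial `x ↦ ∑ i, c i * exp (λ i * x)` has only
finitely many real zeros. -/
theorem finite_real_zeros_of_exponential_polynomial (n : ℕ) (lam c : Fin n → ℂ)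
    (hre : ∀ i j : Fin n, i ≠ j → (lam i).re ≠ (lam j).re) (hc : c ≠ 0) :
    {x : ℝ | ∑ i : Fin n, c i * Complex.exp (lam i * (x : ℂ)) = 0}.Finite := by
  have han : AnalyticOnNhd ℝ (fun x : ℝ ↦ ∑ i, c i * Complex.exp (lam i * (x : ℂ))) Set.univ := by
    refine Finset.analyticOnNhd_fun_sum _ fun i _ x _ ↦ analyticAt_const.mul ?_
    have hexp : AnalyticAt ℝ Complex.exp (lam i * (x : ℂ)) := analyticAt_cexp.restrictScalars
    have hlin : AnalyticAt ℝ (fun y : ℝ ↦ lam i * (y : ℂ)) x :=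
      analyticAt_const.mul (Complex.ofRealCLM.analyticAt x)
    exact AnalyticAt.fun_comp (f := fun y : ℝ ↦ lam i * (y : ℂ)) hexp hlin
  refine han.finite_zeros_of_eventually_cocompact_ne_zero ?_
  rw [cocompact_eq_atBot_atTop, Filter.eventually_sup]
  refine ⟨?_, eventually_atTop_sum_mul_cexp_ne_zero hre hc⟩
  have hneg := eventually_atTop_sum_mul_cexp_ne_zero (lam := fun i ↦ -lam i)
    (fun i j hij ↦ by simpa using hre i j hij) hc
  filter_upwards [Filter.tendsto_neg_atBot_atTop.eventually hneg] with x hx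
  simpa using hx
end

section
/- Let k ≥ 2 and let 0 = i_0 < i_1 < ⋯ < i_k be integers with gcd(i_1,…,i_k) = 1. Define R-linear maps g : R^k → R by g(e_j) = (−1)^{k−j}·S_j for j = 1,…,k, and f : R^{k−1} → R^k by f(ε_s) = (h_{i_1−s}, h_{i_2−s}, …, h_{i_k−s}) for s = 1,…,k−1. Then the sequence 0 → R^{k−1} →(f) R^k →(g) R → R/I_I^A → 0 is exact: f is injective, the kernel of g equals the image of f, and the image of g equals the ideal I_I^A. In particular R/I_I^A has projective dimension 2 as an R-module, i.e. the quotient ring R_I^A is Cohen–Macaulay. -/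
open MvPolynomial

/-- The complete homogeneous symmetric polynomial of degree `d ∈ ℤ` in the variables
`x₁, …, x_k`, with the convention `h_d = 0` for `d < 0` (and `h_0 = 1`). -/
noncomputable def completeHomog (k : ℕ) (d : ℤ) : MvPolynomial (Fin k) ℂ :=
  if 0 ≤ d then
    ∑ μ ∈ Finset.Nat.antidiagonalTuple k d.toNat, ∏ b : Fin k, (X b : MvPolynomial (Fin k) ℂ) ^ μ b
  else 0

/-- The `(k+1) × k` matrix `H` over `R = ℂ[x₁,…,x_k]` with `(a,b)`-entry `h_{i_a - (k - b)}`
(rows `a = 0,…,k`, columns `b = 1,…,k`). -/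
noncomputable def Hmat (k : ℕ) (i : Fin (k + 1) → ℕ) :
    Matrix (Fin (k + 1)) (Fin k) (MvPolynomial (Fin k) ℂ) :=
  Matrix.of fun a b => completeHomog k ((i a : ℤ) - ((k : ℤ) - 1 - (b : ℕ)))

/-- `S_l`, the determinant of the `k × k` matrix obtained from `H` by deleting the row
indexed by `l`; up to sign it is the Schur polynomial of the exponent sequence obtained
from `(i₀,…,i_k)` by deleting `i_l`. -/
noncomputable def Spoly (k : ℕ) (i : Fin (k + 1) → ℕ) (l : Fin (k + 1)) :
    MvPolynomial (Fin k) ℂ :=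
  Matrix.det (Matrix.of fun a b : Fin k => Hmat k i (l.succAbove a) b)

/-- The Vandermonde ideal `I_I^A ⊆ R`, generated by `S₀, S₁, …, S_k`. -/
noncomputable def vandermondeIdealA (k : ℕ) (i : Fin (k + 1) → ℕ) :
    Ideal (MvPolynomial (Fin k) ℂ) :=
  Ideal.span (Set.range (Spoly k i))

namespace Polynomial

lemma signVariations_lt_card_support {P : Polynomial ℝ} (hP : P ≠ 0) :
    P.signVariations < P.support.card := by
  induction h : P.support.card using Nat.strong_induction_on generalizing P with
  | _ c ih =>
    subst h
    by_cases h0 : P.eraseLead = 0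
    · have h1 := eraseLead_add_monomial_natDegree_leadingCoeff P
      rw [h0, zero_add] at h1
      rw [← h1, signVariations_monomial, h1]
      exact Finset.card_pos.mpr (nonempty_support_iff.mpr hP)
    · have h1 := ih _ (eraseLead_support_card_lt hP) h0 rfl
      have h2 := eraseLead_support_card_lt hP
      have h3 := signVariations_le_eraseLead_succ P
      omega

/-- Weak form of Descartes' rule: a nonzero real polynomial has fewer positive roots, counted with
multiplicity, than it has terms. -/
lemma sum_lt_card_support_of_le_rootMultiplicity {ι : Type*} [Fintype ι] {P : Polynomial ℝ}
    (hP : P ≠ 0) (t : ι → ℝ) (ht : Function.Injective t) (hpos : ∀ b, 0 < t b) (e : ι → ℕ)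
    (he : ∀ b, e b ≤ P.rootMultiplicity (t b)) :
    ∑ b, e b < P.support.card := by
  classical
  have hcount : ∑ b, e b ≤ P.roots.countP (0 < ·) := by
    calc ∑ b, e b ≤ ∑ b, P.roots.count (t b) := by
          refine Finset.sum_le_sum fun b _ => ?_
          rw [count_roots]; exact he b
      _ = ∑ x ∈ Finset.univ.image t, (P.roots.filter (0 < ·)).count x := by
          rw [Finset.sum_image fun x _ y _ h => ht h]
          refine Finset.sum_congr rfl fun b _ => ?_
          rw [Multiset.count_filter_of_pos (hpos b)]
      _ ≤ (P.roots.filter (0 < ·)).card := by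
          conv_rhs => rw [← Multiset.toFinset_sum_count_eq]
          refine Finset.sum_le_sum_of_ne_zero fun x _ hx => ?_
          exact Multiset.mem_toFinset.mpr (Multiset.count_ne_zero.mp hx)
      _ = _ := (Multiset.countP_eq_card_filter _ _).symm
  exact hcount.trans_lt
    ((roots_countP_pos_le_signVariations P).trans_lt (signVariations_lt_card_support hP))

end Polynomial

/-- The vector `(x ^ i₀, x ^ i₁, …)`. -/
def powRow {S : Type*} [CommSemiring S] {N : ℕ} (i : Fin N → ℕ) (x : S) : Fin N → S :=
  fun a => x ^ i a

/-- The derivative of `powRow i` at `x`. -/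
def derivRow {S : Type*} [CommSemiring S] {N : ℕ} (i : Fin N → ℕ) (x : S) : Fin N → S :=
  fun a => i a * x ^ (i a - 1)

lemma map_powRow {S T : Type*} [CommSemiring S] [CommSemiring T] {N : ℕ} (i : Fin N → ℕ)
    (φ : S →+* T) (x : S) (a : Fin N) : φ (powRow i x a) = powRow i (φ x) a := by
  simp [powRow]

lemma map_derivRow {S T : Type*} [CommSemiring S] [CommSemiring T] {N : ℕ} (i : Fin N → ℕ)
    (φ : S →+* T) (x : S) (a : Fin N) : φ (derivRow i x a) = derivRow i (φ x) a := by
  simp [derivRow]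

/-- A nontrivial linear relation among the columns yields a sparse polynomial. -/
lemma exists_sparse_polynomial {N : ℕ} {i : Fin N → ℕ} (hi : Function.Injective i)
    {M : Matrix (Fin N) (Fin N) ℝ} (hM : M.det = 0) :
    ∃ P : Polynomial ℝ, P ≠ 0 ∧ P.support.card ≤ N ∧
      (∀ r x, M r = powRow i x → P.IsRoot x) ∧
      (∀ r x, M r = derivRow i x → P.derivative.IsRoot x) := by
  obtain ⟨d, hd, hMd⟩ := Matrix.exists_mulVec_eq_zero_iff.mpr hM
  refine ⟨∑ a, Polynomial.monomial (i a) (d a), ?_, ?_, ?_, ?_⟩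
  · obtain ⟨a, ha⟩ := Function.ne_iff.mp hd
    intro h
    apply ha
    have h1 := congrArg (fun P => Polynomial.coeff P (i a)) h
    simpa [Polynomial.finsetSum_coeff, Polynomial.coeff_monomial, hi.eq_iff] using h1
  · calc _ ≤ (Finset.univ.image i).card := by
          refine Finset.card_le_card fun e he => ?_
          contrapose! he
          simp only [Finset.mem_image, Finset.mem_univ, true_and, not_exists] at he
          simp [Polynomial.finsetSum_coeff, Polynomial.coeff_monomial, he]
      _ ≤ N := Finset.card_image_le.trans (by simp)
  · intro r x hr
    have h1 := congrFun hMd r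
    simp only [Matrix.mulVec, dotProduct, hr, powRow, Pi.zero_apply] at h1
    simp only [Polynomial.IsRoot, Polynomial.eval_finsetSum, Polynomial.eval_monomial]
    rw [← h1]
    exact Finset.sum_congr rfl fun a _ => mul_comm _ _
  · intro r x hr
    have h1 := congrFun hMd r
    simp only [Matrix.mulVec, dotProduct, hr, derivRow, Pi.zero_apply] at h1
    simp only [Polynomial.IsRoot, Polynomial.derivative_sum, Polynomial.derivative_monomial,
      Polynomial.eval_finsetSum, Polynomial.eval_monomial]
    rw [← h1]
    exact Finset.sum_congr rfl fun a _ => by ring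

/-- The matrix with rows `w, r 0, r 1, …`. -/
def border {S : Type*} {N : ℕ} (w : Fin (N + 1) → S) (r : Fin N → Fin (N + 1) → S) :
    Matrix (Fin (N + 1)) (Fin (N + 1)) S :=
  Matrix.of (Fin.cons w r)

lemma border_zero {S : Type*} {N : ℕ} (w : Fin (N + 1) → S) (r : Fin N → Fin (N + 1) → S) :
    border w r 0 = w := rfl

lemma border_succ {S : Type*} {N : ℕ} (w : Fin (N + 1) → S) (r : Fin N → Fin (N + 1) → S)
    (b : Fin N) : border w r b.succ = r b := rfl

section RealDet

variable {n : ℕ} {i : Fin (n + 2) → ℕ}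

lemma det_double_point_ne_zero (hi : Function.Injective i) (t : Fin (n + 1) → ℝ)
    (ht : Function.Injective t) (hpos : ∀ b, 0 < t b) {m j : Fin (n + 1)} (hjm : j ≠ m) :
    (border (powRow i (t m)) (Function.update (fun b => powRow i (t b)) m (derivRow i (t j)))).det ≠ 0 := by
  intro h
  obtain ⟨P, hP, hcard, hpow, hder⟩ := exists_sparse_polynomial hi h
  have hroot : ∀ b, P.IsRoot (t b) := fun b => by
    by_cases hb : b = m
    · exact hpow 0 _ (by subst hb; rfl)
    · exact hpow b.succ _ (by rw [border_succ, Function.update_of_ne hb])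
  have hroot' : P.derivative.IsRoot (t j) := hder m.succ _ (by rw [border_succ, Function.update_self])
  have := Polynomial.sum_lt_card_support_of_le_rootMultiplicity hP t ht hpos
    (fun b => 1 + if b = j then 1 else 0) (fun b => by
      split_ifs with hb
      · exact (Polynomial.one_lt_rootMultiplicity_iff_isRoot hP).mpr ⟨hroot b, hb ▸ hroot'⟩
      · exact (Polynomial.rootMultiplicity_pos hP).mpr (hroot b))
  simp [Finset.sum_add_distrib] at this
  omega

lemma det_two_double_points_ne_zero (hi : Function.Injective i) (t : Fin (n + 1) → ℝ)
    (ht : Function.Injective t) (hpos : ∀ b, 0 < t b) {m j l : Fin (n + 1)} (hjm : j ≠ m)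
    (hlm : l ≠ m) (hlj : l ≠ j) :
    (border (derivRow i (t l)) (Function.update (fun b => powRow i (t b)) m (derivRow i (t j)))).det ≠ 0 := by
  intro h
  obtain ⟨P, hP, hcard, hpow, hder⟩ := exists_sparse_polynomial hi h
  have hroot : ∀ b, b ≠ m → P.IsRoot (t b) := fun b hb => hpow b.succ _ (by rw [border_succ, Function.update_of_ne hb])
  have hrootj : P.derivative.IsRoot (t j) := hder m.succ _ (by rw [border_succ, Function.update_self])
  have hrootl : P.derivative.IsRoot (t l) := hder 0 _ rfl
  have hlt := Polynomial.sum_lt_card_support_of_le_rootMultiplicity hP t ht hpos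
    (fun b => if b = m then 0 else if b = j ∨ b = l then 2 else 1) (fun b => by
      split_ifs with hb hb'
      · exact Nat.zero_le _
      · refine (Polynomial.one_lt_rootMultiplicity_iff_isRoot hP).mpr ⟨hroot b hb, ?_⟩
        rcases hb' with rfl | rfl <;> assumption
      · exact (Polynomial.rootMultiplicity_pos hP).mpr (hroot b hb))
  have hsum : ∑ b : Fin (n + 1), ((if b = m then 0 else if b = j ∨ b = l then 2 else 1) +
      if b = m then 1 else 0) =
      ∑ b : Fin (n + 1), ((1 + if b = j then 1 else 0) + if b = l then 1 else 0) :=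
    Finset.sum_congr rfl fun b _ => by grind
  simp only [Finset.sum_add_distrib] at hsum
  simp at hsum
  omega

end RealDet

lemma map_border {S T : Type*} {N : ℕ} (φ : S → T) (w : Fin (N + 1) → S)
    (r : Fin N → Fin (N + 1) → S) :
    (border w r).map φ = border (φ ∘ w) (fun b => φ ∘ r b) := by
  ext a c
  refine Fin.cases ?_ (fun b => ?_) a <;> rfl

lemma det_border {S : Type*} [CommRing S] {N : ℕ} (w : Fin (N + 1) → S)
    (r : Fin N → Fin (N + 1) → S) :
    (border w r).det =
      ∑ l : Fin (N + 1), (-1) ^ (l : ℕ) * w l * (Matrix.of fun b a => r b (l.succAbove a)).det :=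
  Matrix.det_succ_row_zero _

lemma border_update_succ {S : Type*} {N : ℕ} (w v : Fin (N + 1) → S)
    (r : Fin N → Fin (N + 1) → S) (b : Fin N) :
    border w (Function.update r b v) = (border w r).updateRow b.succ v := by
  ext a c
  refine Fin.cases ?_ (fun d => ?_) a
  · rw [border_zero, Matrix.updateRow_ne (Fin.succ_ne_zero _).symm, border_zero]
  · rw [border_succ]
    by_cases h : d = b
    · subst h; simp
    · rw [Function.update_of_ne h, Matrix.updateRow_ne (by simpa using h), border_succ]

lemma Matrix.det_mem_of_entries_mem {R A ι : Type*} [CommRing R] [CommRing A] [Algebra R A]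
    [Fintype ι] [DecidableEq ι] (S : Subalgebra R A) (M : Matrix ι ι A) (hM : ∀ a b, M a b ∈ S) :
    M.det ∈ S := by
  rw [Matrix.det_apply]
  exact S.sum_mem fun σ _ => zsmul_mem (S.prod_mem fun b _ => hM _ _) _

namespace MvPolynomial

lemma vars_subset_of_dvd {σ R : Type*} [CommRing R] [IsDomain R] {p q : MvPolynomial σ R}
    (h : p ∣ q) (hq : q ≠ 0) : p.vars ⊆ q.vars := by
  obtain ⟨r, rfl⟩ := h
  intro m hm
  rw [mem_vars_iff_degreeOf_ne_zero] at hm ⊢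
  rw [degreeOf_mul_eq (left_ne_zero_of_mul hq) (right_ne_zero_of_mul hq)]
  omega

lemma exists_mem_vars_of_irreducible {σ : Type*} {p : MvPolynomial σ ℂ} (hp : Irreducible p) :
    ∃ m, m ∈ p.vars := by
  by_contra! h
  have h0 : p.vars = ∅ := Finset.eq_empty_of_forall_notMem h
  rw [vars_eq_empty_iff_eq_C] at h0
  have hc0 : p.coeff 0 ≠ 0 := fun h1 => hp.ne_zero (by rw [h0, h1, C_0])
  exact hp.not_isUnit (h0 ▸ (isUnit_iff_ne_zero.mpr hc0).map C)

lemma not_dvd_of_mem_supported {σ : Type*} {p q : MvPolynomial σ ℂ} {m : σ} (hm : m ∈ p.vars)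
    (hq : q ∈ supported ℂ ({m}ᶜ : Set σ)) (hq0 : q ≠ 0) : ¬ p ∣ q := fun h =>
  mem_supported.mp hq (vars_subset_of_dvd h hq0 hm) rfl

/-- If only the row `j` of a matrix involves the variable `x_j`, its determinant is differentiated
by differentiating that row. -/
lemma pderiv_det {σ R ι : Type*} [CommRing R] [Fintype ι] [DecidableEq ι] (v : σ)
    (j : ι) (M : Matrix ι ι (MvPolynomial σ R)) (hM : ∀ b, b ≠ j → ∀ a, pderiv v (M b a) = 0) :
    pderiv v M.det = (M.updateRow j fun a => pderiv v (M j a)).det := by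
  rw [← Matrix.det_transpose, ← Matrix.det_transpose (M.updateRow j _), Matrix.det_apply,
    Matrix.det_apply, map_sum]
  refine Finset.sum_congr rfl fun σ _ => ?_
  rw [Units.smul_def, Units.smul_def, map_zsmul]
  congr 1
  simp only [Matrix.transpose_apply]
  rw [← Finset.mul_prod_erase _ _ (Finset.mem_univ j),
    ← Finset.mul_prod_erase _ (fun b => M.updateRow j _ b (σ b)) (Finset.mem_univ j),
    Derivation.leibniz, Matrix.updateRow_self]
  have h0 : pderiv v (∏ b ∈ Finset.univ.erase j, M b (σ b)) = 0 := by
    refine Finset.prod_induction _ (fun q => pderiv v q = 0) (fun p q hp hq => ?_) (by simp)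
      fun b hb => hM b (Finset.ne_of_mem_erase hb) _
    rw [Derivation.leibniz, hp, hq, smul_zero, smul_zero, add_zero]
  rw [h0, smul_zero, zero_add, smul_eq_mul, mul_comm]
  congr 1
  exact Finset.prod_congr rfl fun b hb => by rw [Matrix.updateRow_ne (Finset.ne_of_mem_erase hb)]

end MvPolynomial

section Generic

variable {n : ℕ} {i : Fin (n + 2) → ℕ}

lemma border_update_mem_supported {m j : Fin (n + 1)} (hjm : j ≠ m)
    {w : Fin (n + 2) → MvPolynomial (Fin (n + 1)) ℂ}
    (hw : ∀ a, w a ∈ supported ℂ ({m}ᶜ : Set (Fin (n + 1)))) :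
    (border w (Function.update (fun b => powRow i (X b)) m (derivRow i (X j)))).det ∈
      supported ℂ ({m}ᶜ : Set (Fin (n + 1))) := by
  refine Matrix.det_mem_of_entries_mem _ _ fun a c => ?_
  refine Fin.cases (hw c) (fun b => ?_) a
  rw [border_succ]
  have hX : ∀ b, b ≠ m → (X b : MvPolynomial (Fin (n + 1)) ℂ) ∈ supported ℂ ({m}ᶜ : Set _) :=
    fun b hb => X_mem_supported.mpr hb
  by_cases hb : b = m
  · subst hb
    rw [Function.update_self]
    exact mul_mem (natCast_mem _ _) (pow_mem (hX j hjm) _)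
  · rw [Function.update_of_ne hb]
    exact pow_mem (hX b hb) _

lemma eval_border_update (t : Fin (n + 1) → ℝ) (m j : Fin (n + 1))
    {w : Fin (n + 2) → MvPolynomial (Fin (n + 1)) ℂ} {w' : Fin (n + 2) → ℝ}
    (hw : ∀ a, eval (fun b => (t b : ℂ)) (w a) = w' a) :
    eval (fun b => (t b : ℂ))
        (border w (Function.update (fun b => powRow i (X b)) m (derivRow i (X j)))).det =
      ((border w' (Function.update (fun b => powRow i (t b)) m (derivRow i (t j)))).det : ℝ) := by
  rw [RingHom.map_det, ← Complex.ofRealHom_eq_coe, RingHom.map_det]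
  congr 1
  ext a c
  rw [RingHom.mapMatrix_apply, RingHom.mapMatrix_apply, Matrix.map_apply, Matrix.map_apply]
  refine Fin.cases (hw c) (fun b => ?_) a
  rw [border_succ, border_succ]
  by_cases hb : b = m
  · subst hb
    rw [Function.update_self, Function.update_self, map_derivRow, map_derivRow, eval_X]
    rfl
  · rw [Function.update_of_ne hb, Function.update_of_ne hb, map_powRow, map_powRow, eval_X]
    rfl

/-- A real sample point with distinct positive coordinates. -/
lemma samplePoint_injective_pos (N : ℕ) :
    Function.Injective (fun b : Fin N => ((b : ℕ) : ℝ) + 1) ∧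
      ∀ b : Fin N, (0 : ℝ) < ((b : ℕ) : ℝ) + 1 :=
  ⟨fun a b h => Fin.ext (by simpa using h), fun b => by positivity⟩

lemma exists_not_dvd_double_point (hi : Function.Injective i)
    {p : MvPolynomial (Fin (n + 1)) ℂ} {m j : Fin (n + 1)} (hm : m ∈ p.vars) (hjm : j ≠ m) :
    ∃ w, ¬ p ∣ (border w (Function.update (fun b => powRow i (X b)) m (derivRow i (X j)))).det := by
  obtain ⟨ht, hpos⟩ := samplePoint_injective_pos (n + 1)
  refine ⟨fun a => C ((powRow i (((m : ℕ) : ℝ) + 1) a : ℝ) : ℂ),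
    not_dvd_of_mem_supported hm (border_update_mem_supported hjm fun a =>
      Subalgebra.algebraMap_mem _ _) fun h => ?_⟩
  have h1 := eval_border_update (i := i) (fun b : Fin (n + 1) => ((b : ℕ) : ℝ) + 1) m j
    (w := fun a => C ((powRow i (((m : ℕ) : ℝ) + 1) a : ℝ) : ℂ)) (fun a => by rw [eval_C])
  rw [h, map_zero, eq_comm, Complex.ofReal_eq_zero] at h1
  exact det_double_point_ne_zero hi _ ht hpos hjm h1

lemma not_dvd_two_double_points (hi : Function.Injective i)
    {p : MvPolynomial (Fin (n + 1)) ℂ} {m j l : Fin (n + 1)} (hm : m ∈ p.vars) (hjm : j ≠ m)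
    (hlm : l ≠ m) (hlj : l ≠ j) :
    ¬ p ∣ (border (derivRow i (X l))
      (Function.update (fun b => powRow i (X b)) m (derivRow i (X j)))).det := by
  obtain ⟨ht, hpos⟩ := samplePoint_injective_pos (n + 1)
  refine not_dvd_of_mem_supported hm (border_update_mem_supported hjm fun a =>
      mul_mem (natCast_mem _ _) (pow_mem (X_mem_supported.mpr hlm) _)) fun h => ?_
  have hw : ∀ a, eval (fun b : Fin (n + 1) => ((((b : ℕ) : ℝ) + 1 : ℝ) : ℂ)) (derivRow i (X l) a) =
      (derivRow i (((l : ℕ) : ℝ) + 1) a : ℝ) := fun a => by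
    rw [map_derivRow, eval_X, ← Complex.ofRealHom_eq_coe]
    exact (map_derivRow i Complex.ofRealHom _ a).symm
  have h1 := eval_border_update (i := i) (fun b : Fin (n + 1) => ((b : ℕ) : ℝ) + 1) m j hw
  rw [h, map_zero, eq_comm, Complex.ofReal_eq_zero] at h1
  exact det_two_double_points_ne_zero hi _ ht hpos hjm hlm hlj h1

end Generic

section Factorization

variable {n : ℕ}

lemma mk_completeHomog (N : ℕ) :
    PowerSeries.mk (fun d => completeHomog N (d : ℤ)) =
      ∏ b : Fin N, PowerSeries.mk fun e => (X b : MvPolynomial (Fin N) ℂ) ^ e := by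
  ext1 d
  rw [PowerSeries.coeff_prod, PowerSeries.coeff_mk, completeHomog, if_pos (Int.natCast_nonneg d),
    Int.toNat_natCast]
  refine Finset.sum_nbij' (fun μ => Finsupp.equivFunOnFinite.symm μ) (fun μ => ⇑μ) ?_ ?_ ?_ ?_ ?_
  · intro μ hμ
    simpa [Finset.mem_finsuppAntidiag, Finset.Nat.mem_antidiagonalTuple] using hμ
  · intro μ hμ
    simpa [Finset.mem_finsuppAntidiag, Finset.Nat.mem_antidiagonalTuple] using hμ
  · intro μ _; rfl
  · intro μ _; ext; rfl
  · intro μ _; simp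

/-- The polynomial `∏_{c ≠ b} (1 - x_c T)`. -/
noncomputable def complementPoly (b : Fin (n + 1)) :
    Polynomial (MvPolynomial (Fin (n + 1)) ℂ) :=
  ∏ c ∈ Finset.univ.erase b, (1 - Polynomial.C (X c) * Polynomial.X)

lemma natDegree_complementPoly_le (b : Fin (n + 1)) : (complementPoly b).natDegree ≤ n := by
  refine (Polynomial.natDegree_prod_le _ _).trans ?_
  calc _ ≤ ∑ _c ∈ Finset.univ.erase b, 1 := by
        refine Finset.sum_le_sum fun c _ => ?_
        refine (Polynomial.natDegree_sub_le _ _).trans ?_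
        simp
    _ = n := by simp

lemma complementPoly_mul_mk (b : Fin (n + 1)) :
    (complementPoly b : PowerSeries (MvPolynomial (Fin (n + 1)) ℂ)) *
        PowerSeries.mk (fun d => completeHomog (n + 1) (d : ℤ)) =
      PowerSeries.mk fun e => (X b) ^ e := by
  have hgeom : ∀ x : MvPolynomial (Fin (n + 1)) ℂ,
      (1 - PowerSeries.C x * PowerSeries.X) * PowerSeries.mk (fun e => x ^ e) = 1 := by
    intro x
    ext1 d
    rw [sub_mul, one_mul, mul_assoc, map_sub, PowerSeries.coeff_C_mul, PowerSeries.coeff_mk]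
    cases d with
    | zero => simp
    | succ d => simp [PowerSeries.coeff_succ_X_mul, PowerSeries.coeff_one, pow_succ']
  rw [mk_completeHomog, ← Finset.mul_prod_erase _ _ (Finset.mem_univ b), mul_left_comm,
    complementPoly, ← Polynomial.coeToPowerSeries.ringHom_apply, map_prod,
    ← Finset.prod_mul_distrib, Finset.prod_eq_one, mul_one]
  intro c _
  rw [← hgeom (X c)]
  simp

/-- The transition matrix from complete homogeneous polynomials to powers of the variables. -/
noncomputable def transitionMatrix (n : ℕ) :
    Matrix (Fin (n + 1)) (Fin (n + 1)) (MvPolynomial (Fin (n + 1)) ℂ) :=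
  Matrix.of fun s b => (complementPoly b).coeff (n - s)

lemma X_pow_eq_sum_completeHomog (b : Fin (n + 1)) (d : ℕ) :
    (X b : MvPolynomial (Fin (n + 1)) ℂ) ^ d =
      ∑ s : Fin (n + 1), completeHomog (n + 1) ((d : ℤ) - (((n + 1 : ℕ) : ℤ) - 1 - (s : ℕ))) *
        transitionMatrix n s b := by
  have h := congrArg (PowerSeries.coeff d) (complementPoly_mul_mk b)
  rw [PowerSeries.coeff_mul, PowerSeries.coeff_mk, Finset.Nat.sum_antidiagonal_eq_sum_range_succ_mk]
    at h
  simp only [Polynomial.coeff_coe, PowerSeries.coeff_mk] at h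
  set F : ℕ → MvPolynomial (Fin (n + 1)) ℂ := fun v =>
    (complementPoly b).coeff v * completeHomog (n + 1) ((d : ℤ) - v) with hF
  have h1 : ∑ v ∈ Finset.range (d + 1), F v = ∑ v ∈ Finset.range (n + 1), F v := by
    rw [Finset.sum_subset (Finset.range_mono (show d + 1 ≤ d + n + 1 by omega)) fun v _ hv => ?_,
      Finset.sum_subset (Finset.range_mono (show n + 1 ≤ d + n + 1 by omega)) fun v _ hv => ?_]
    · rw [Finset.mem_range, not_lt] at hv
      rw [hF]
      dsimp only
      rw [Polynomial.coeff_eq_zero_of_natDegree_lt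
        ((natDegree_complementPoly_le b).trans_lt (by omega)), zero_mul]
    · rw [Finset.mem_range, not_lt] at hv
      rw [hF]
      dsimp only
      rw [completeHomog, if_neg (by omega), mul_zero]
  rw [← h]
  calc _ = ∑ v ∈ Finset.range (d + 1), F v := by
        refine Finset.sum_congr rfl fun v hv => ?_
        rw [Finset.mem_range] at hv
        rw [hF]
        dsimp only
        rw [Nat.cast_sub (by omega)]
    _ = ∑ s : Fin (n + 1), F (n - s) := by
        rw [h1, ← Finset.sum_range_reflect, Finset.sum_range fun v => F (n + 1 - 1 - v)]
        rfl
    _ = _ := by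
        refine Finset.sum_congr rfl fun s _ => ?_
        rw [hF, mul_comm]
        dsimp only [transitionMatrix, Matrix.of_apply]
        congr 2
        have := s.isLt
        omega

lemma det_powRow_eq (i : Fin (n + 2) → ℕ) (l : Fin (n + 2)) :
    (Matrix.of fun b a : Fin (n + 1) =>
        powRow i (X b : MvPolynomial (Fin (n + 1)) ℂ) (l.succAbove a)).det =
      Spoly (n + 1) i l * (transitionMatrix n).det := by
  rw [Spoly, ← Matrix.det_mul, ← Matrix.det_transpose]
  congr 1
  ext1 a b
  rw [Matrix.mul_apply]
  exact X_pow_eq_sum_completeHomog b _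

lemma map_det_transitionMatrix_eq_zero {L : Type*} [CommRing L]
    (φ : MvPolynomial (Fin (n + 1)) ℂ →+* L) {m j : Fin (n + 1)} (hjm : j ≠ m)
    (h : φ (X j) = φ (X m)) : φ (transitionMatrix n).det = 0 := by
  rw [RingHom.map_det]
  refine Matrix.det_zero_of_column_eq hjm fun s => ?_
  have hp : (complementPoly j).map φ = (complementPoly m).map φ := by
    have key : ∀ b b' : Fin (n + 1), b ≠ b' → (complementPoly b).map φ =
        (1 - Polynomial.C (φ (X b')) * Polynomial.X) * ∏ c ∈ (Finset.univ.erase b).erase b',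
          (1 - Polynomial.C (φ (X c)) * Polynomial.X) := by
      intro b b' hb
      rw [Finset.mul_prod_erase (Finset.univ.erase b)
        (fun c => 1 - Polynomial.C (φ (X c)) * Polynomial.X)
        (Finset.mem_erase.mpr ⟨hb.symm, Finset.mem_univ b'⟩)]
      simp [complementPoly, Polynomial.map_prod]
    rw [key j m hjm, key m j hjm.symm, h, Finset.erase_right_comm]
  simpa [transitionMatrix] using congrArg (fun P => P.coeff (n - s)) hp

end Factorization

section LinearAlgebra

/-- Exchanging rows `j` and `m` after a linear relation among the rows `Y b`. -/
lemma mul_det_border_update {L : Type*} [CommRing L] {N : ℕ} {Y : Fin N → Fin (N + 1) → L}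
    {c : Fin N → L} (hc : ∑ b, c b • Y b = 0) {m j : Fin N} (hjm : j ≠ m)
    (w z : Fin (N + 1) → L) :
    c m * (border w (Function.update Y j z)).det =
      c j * (border w (Function.update Y m z)).det := by
  have hsum : ∑ x, (Fin.cons 0 (Function.update c j 0) : Fin (N + 1) → L) x •
      border w (Function.update Y j z) x = -(c j • Y j) := by
    rw [Fin.sum_univ_succ, Fin.cons_zero, zero_smul, zero_add, eq_neg_iff_add_eq_zero, ← hc,
      ← Finset.add_sum_erase _ _ (Finset.mem_univ j),
      ← Finset.add_sum_erase _ (fun b => c b • Y b) (Finset.mem_univ j), Fin.cons_succ,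
      Function.update_self, zero_smul, zero_add, add_comm (c j • Y j)]
    refine congrArg (· + c j • Y j) ?_
    refine Finset.sum_congr rfl fun b hb => ?_
    rw [Fin.cons_succ, border_succ, Function.update_of_ne (Finset.ne_of_mem_erase hb),
      Function.update_of_ne (Finset.ne_of_mem_erase hb)]
  have h1 := Matrix.det_updateRow_sum (border w (Function.update Y j z)) m.succ
    (Fin.cons 0 (Function.update c j 0))
  rw [hsum, Fin.cons_succ, Function.update_of_ne hjm.symm, smul_eq_mul] at h1
  rw [← h1, ← neg_smul, Matrix.det_updateRow_smul]
  have hswap : (border w (Function.update Y j z)).updateRow m.succ (Y j) =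
      (border w (Function.update Y m z)).submatrix (Equiv.swap j.succ m.succ) id := by
    rw [← border_update_succ]
    ext x a
    rw [Matrix.submatrix_apply, id]
    refine Fin.cases ?_ (fun b => ?_) x
    · rw [Equiv.swap_apply_of_ne_of_ne (Fin.succ_ne_zero _).symm (Fin.succ_ne_zero _).symm,
        border_zero, border_zero]
    · by_cases hbm : b = m
      · subst hbm
        rw [Equiv.swap_apply_right, border_succ, border_succ, Function.update_self,
          Function.update_of_ne hjm]
      · by_cases hbj : b = j
        · subst hbj
          rw [Equiv.swap_apply_left, border_succ, border_succ, Function.update_of_ne hjm,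
            Function.update_self, Function.update_self]
        · rw [Equiv.swap_apply_of_ne_of_ne (by simpa using hbj) (by simpa using hbm), border_succ,
            border_succ, Function.update_of_ne hbm, Function.update_of_ne hbj,
            Function.update_of_ne hbm]
  rw [hswap, Matrix.det_permute, Equiv.Perm.sign_swap (by simpa using hjm)]
  simp

lemma exists_relation_of_minors_eq_zero {L : Type*} [Field L] {N : ℕ} {Y : Fin N → Fin (N + 1) → L}
    (hY : ∀ l : Fin (N + 1), (Matrix.of fun b a => Y b (l.succAbove a)).det = 0) :
    ∃ c : Fin N → L, ∑ b, c b • Y b = 0 ∧ c ≠ 0 := by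
  by_contra! hcon
  have hli : LinearIndependent L Y := by
    rw [Fintype.linearIndependent_iff]
    exact fun c hc => congrFun (hcon c hc)
  obtain ⟨w, hw⟩ : ∃ w, w ∉ Submodule.span L (Set.range Y) := by
    by_contra! h
    have h1 := finrank_span_eq_card hli
    rw [Submodule.eq_top_iff'.mpr h, finrank_top] at h1
    simp at h1
  have h2 : LinearIndependent L (border w Y).row :=
    linearIndependent_finCons.mpr ⟨hli, hw⟩
  rw [Matrix.linearIndependent_rows_iff_isUnit, Matrix.isUnit_iff_isUnit_det, det_border] at h2
  simp [hY] at h2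

lemma eq_zero_of_relation {L : Type*} [Field L] {N : ℕ} {Y : Fin N → Fin (N + 1) → L}
    {c : Fin N → L} (hc : ∑ b, c b • Y b = 0) {m : Fin N} (hm : c m = 0)
    {w z : Fin (N + 1) → L} (h : (border w (Function.update Y m z)).det ≠ 0) : c = 0 := by
  by_contra hne
  refine h (Matrix.exists_vecMul_eq_zero_iff.mp ⟨Fin.cons 0 c, ?_, ?_⟩)
  · obtain ⟨b, hb⟩ := Function.ne_iff.mp hne
    exact Function.ne_iff.mpr ⟨b.succ, by simpa using hb⟩
  · rw [Matrix.vecMul_eq_sum, Fin.sum_univ_succ, Fin.cons_zero, zero_smul, zero_add, ← hc]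
    refine Finset.sum_congr rfl fun b _ => ?_
    rw [Fin.cons_succ, border_succ]
    by_cases hb : b = m
    · subst hb; rw [hm, zero_smul, zero_smul]
    · rw [Function.update_of_ne hb]

end LinearAlgebra

section Coprime

variable {n : ℕ} {i : Fin (n + 2) → ℕ}

lemma eq_of_pow_eq {L : Type*} [Field L] {N : ℕ} {i : Fin (N + 1) → ℕ}
    (hgcd : Finset.gcd (Finset.Ioi 0) i = 1) {x y : L} (hx : x ≠ 0)
    (h : ∀ a, y ^ i a = x ^ i a) : x = y := by
  have h1 : orderOf (y / x) ∣ Finset.gcd (Finset.Ioi 0) i :=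
    Finset.dvd_gcd fun a _ => orderOf_dvd_of_pow_eq_one (by
      rw [div_pow, h a, div_self (pow_ne_zero _ hx)])
  rw [hgcd, Nat.dvd_one, orderOf_eq_one_iff, div_eq_one_iff_eq hx] at h1
  exact h1.symm

lemma map_pderiv_det {L : Type*} [CommRing L] (φ : MvPolynomial (Fin (n + 1)) ℂ →+* L)
    (j : Fin (n + 1)) (l : Fin (n + 2)) :
    φ (pderiv j (Matrix.of fun b a : Fin (n + 1) => powRow i
        (X b : MvPolynomial (Fin (n + 1)) ℂ) (l.succAbove a)).det) =
      (Matrix.of fun b a : Fin (n + 1) => Function.update (fun b => powRow i (φ (X b))) j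
        (derivRow i (φ (X j))) b (l.succAbove a)).det := by
  rw [pderiv_det j j, RingHom.map_det]
  · congr 1
    ext b a
    rw [RingHom.mapMatrix_apply, Matrix.map_apply, Matrix.of_apply]
    by_cases hb : b = j
    · subst hb
      rw [Matrix.updateRow_self, Function.update_self, Matrix.of_apply, powRow,
        Derivation.leibniz_pow, pderiv_X_self]
      simp [derivRow]
    · rw [Matrix.updateRow_ne hb, Function.update_of_ne hb, Matrix.of_apply, map_powRow]
  · intro b hb a
    rw [Matrix.of_apply, powRow, Derivation.leibniz_pow, pderiv_X_of_ne hb, smul_zero, smul_zero]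

lemma map_border_update {L : Type*} [CommRing L] (φ : MvPolynomial (Fin (n + 1)) ℂ →+* L)
    (w : Fin (n + 2) → MvPolynomial (Fin (n + 1)) ℂ) (m j : Fin (n + 1)) :
    φ (border w (Function.update (fun b => powRow i (X b)) m (derivRow i (X j)))).det =
      (border (φ ∘ w) (Function.update (fun b => powRow i (φ (X b))) m
        (derivRow i (φ (X j))))).det := by
  rw [RingHom.map_det]
  congr 1
  ext a c
  refine Fin.cases rfl (fun b => ?_) a
  rw [RingHom.mapMatrix_apply, Matrix.map_apply, border_succ, border_succ]
  by_cases hb : b = m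
  · subst hb
    rw [Function.update_self, Function.update_self, map_derivRow]
  · rw [Function.update_of_ne hb, Function.update_of_ne hb, map_powRow]

lemma border_self_det {L : Type*} [CommRing L] {N : ℕ} (Y : Fin N → Fin (N + 1) → L) (m : Fin N)
    (z : Fin (N + 1) → L) : (border z (Function.update Y m z)).det = 0 :=
  Matrix.det_zero_of_row_eq (Fin.succ_ne_zero m).symm
    (by rw [border_zero, border_succ, Function.update_self])

/-- The polynomials `S₀, …, S_k` have no common irreducible factor. -/
theorem exists_not_dvd_Spoly (hn : 1 ≤ n) (hi0 : i 0 = 0) (hi : Function.Injective i)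
    (hgcd : Finset.gcd (Finset.Ioi 0) i = 1) {p : MvPolynomial (Fin (n + 1)) ℂ}
    (hp : Irreducible p) : ∃ l, ¬ p ∣ Spoly (n + 1) i l := by
  by_contra! hdvd
  obtain ⟨m, hm⟩ := exists_mem_vars_of_irreducible hp
  have hprime : (Ideal.span {p}).IsPrime :=
    (Ideal.span_singleton_prime hp.ne_zero).mpr hp.prime
  let L := FractionRing (MvPolynomial (Fin (n + 1)) ℂ ⧸ Ideal.span {p})
  let φ : MvPolynomial (Fin (n + 1)) ℂ →+* L :=
    (algebraMap (MvPolynomial (Fin (n + 1)) ℂ ⧸ Ideal.span {p}) L).comp (Ideal.Quotient.mk _)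
  have hφ : ∀ q, φ q = 0 ↔ p ∣ q := fun q => by
    rw [← Ideal.mem_span_singleton, ← Ideal.Quotient.eq_zero_iff_mem, RingHom.comp_apply,
      map_eq_zero_iff _ (IsFractionRing.injective _ _)]
  clear_value φ
  set Y : Fin (n + 1) → Fin (n + 2) → L := fun b => powRow i (φ (X b)) with hY
  set Z : Fin (n + 1) → Fin (n + 2) → L := fun b => derivRow i (φ (X b)) with hZ
  have hN1 : ∀ j, j ≠ m → ∃ w, (border w (Function.update Y m (Z j))).det ≠ 0 := fun j hj => by
    obtain ⟨w, hw⟩ := exists_not_dvd_double_point hi hm hj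
    rw [← hφ, map_border_update] at hw
    exact ⟨_, hw⟩
  have hN2 : ∀ j l, j ≠ m → l ≠ m → l ≠ j →
      (border (Z l) (Function.update Y m (Z j))).det ≠ 0 := fun j l hj hl hlj => by
    have hw := not_dvd_two_double_points hi hm hj hl hlj
    rw [← hφ, map_border_update] at hw
    convert hw using 3
    ext a
    exact (map_derivRow i φ _ a).symm
  set A : Fin (n + 2) → MvPolynomial (Fin (n + 1)) ℂ := fun l =>
    (Matrix.of fun b a : Fin (n + 1) => powRow i (X b) (l.succAbove a)).det with hA
  have hAS : ∀ l, A l = Spoly (n + 1) i l * (transitionMatrix n).det := det_powRow_eq i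
  choose B hB using hdvd
  have hG : ∀ j w, (border w (Function.update Y j (Z j))).det =
      ∑ l : Fin (n + 2), (-1) ^ (l : ℕ) * w l * φ (pderiv j (A l)) := fun j w => by
    rw [det_border]
    exact Finset.sum_congr rfl fun l _ => by rw [hA]; dsimp only; rw [map_pderiv_det]
  have hφp : φ p = 0 := (hφ p).mpr dvd_rfl
  have hpd : ∀ j l, φ (pderiv j (A l)) =
      φ (pderiv j p) * (φ (B l) * φ (transitionMatrix n).det) := fun j l => by
    rw [hAS, hB, mul_assoc, Derivation.leibniz, smul_eq_mul, smul_eq_mul, map_add,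
      map_mul φ p, hφp, map_mul φ, map_mul φ]
    ring
  obtain ⟨c, hc, hc0⟩ := exists_relation_of_minors_eq_zero (Y := Y) fun l => by
    have h : φ (A l) = 0 := by rw [hAS, hB, map_mul, map_mul, hφp, zero_mul, zero_mul]
    rw [hA, RingHom.map_det] at h
    refine (congrArg Matrix.det ?_).trans h
    ext b a
    exact (map_powRow i φ _ _).symm
  have hZG : ∀ j w, j ≠ m → c m * (φ (pderiv j p) *
      ∑ l : Fin (n + 2), (-1) ^ (l : ℕ) * w l * (φ (B l) * φ (transitionMatrix n).det)) =
      c j * (border w (Function.update Y m (Z j))).det := fun j w hj => by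
    rw [← mul_det_border_update hc hj, hG, Finset.mul_sum]
    congr 1
    exact Finset.sum_congr rfl fun l _ => by rw [hpd]; ring
  have : Nontrivial (Fin (n + 1)) := Fin.nontrivial_iff_two_le.mpr (by omega)
  have hcm : c m ≠ 0 := fun h => by
    obtain ⟨j, hj⟩ := exists_ne m
    obtain ⟨w, hw⟩ := hN1 j hj
    exact hc0 (eq_zero_of_relation hc h hw)
  have hrel : ∀ a, ∑ b, c b * φ (X b) ^ i a = 0 := fun a => by
    have := congrFun hc a
    simpa [hY, powRow] using this
  obtain ⟨j, hj, hcj⟩ : ∃ j, j ≠ m ∧ c j ≠ 0 := by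
    by_contra! h
    have h1 := hrel 0
    rw [Finset.sum_eq_single m (fun b _ hb => by rw [h b hb, zero_mul])
      (fun h => absurd (Finset.mem_univ m) h), hi0, pow_zero, mul_one] at h1
    exact hcm h1
  have hcl : ∀ l, l ≠ m → l ≠ j → c l = 0 := fun l hl hlj => by
    have h1 := hZG j (Z l) hj
    have h2 := hZG l (Z l) hl
    have h3 := hZG l (Z j) hl
    rw [border_self_det, mul_zero] at h2
    have h4 := mul_ne_zero hcj (hN2 j l hj hl hlj)
    rw [← h1] at h4
    have h5 := right_ne_zero_of_mul (right_ne_zero_of_mul h4)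
    have h6 : φ (pderiv l p) = 0 := by simpa [hcm, h5] using h2
    rw [h6, zero_mul, mul_zero, eq_comm] at h3
    exact (mul_eq_zero.mp h3).resolve_right (hN2 l j hl hj hlj.symm)
  have hrel2 : ∀ a, c j * φ (X j) ^ i a + c m * φ (X m) ^ i a = 0 := fun a => by
    rw [← hrel a]
    exact (Fintype.sum_eq_add (f := fun b => c b * φ (X b) ^ i a) j m hj fun b hb => by
      rw [hcl b hb.2 hb.1, zero_mul]).symm
  have hcjm : c j = -c m := by
    have := hrel2 0
    rw [hi0, pow_zero, pow_zero, mul_one, mul_one] at this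
    exact eq_neg_of_add_eq_zero_left this
  have hXj : φ (X j) ≠ 0 := fun h =>
    not_dvd_of_mem_supported hm (X_mem_supported.mpr hj) (X_ne_zero j) ((hφ _).mp h)
  have hX : φ (X j) = φ (X m) := eq_of_pow_eq hgcd hXj fun a => by
    have := hrel2 a
    rw [hcjm] at this
    refine mul_left_cancel₀ hcm ?_
    linear_combination this
  obtain ⟨w, hw⟩ := hN1 j hj
  refine mul_ne_zero hcj hw ?_
  rw [← hZG j w hj, map_det_transitionMatrix_eq_zero φ hj hX]
  simp

end Coprime

section HilbertBurch

lemma dvd_of_forall_dvd_mul {R ι : Type*} [CommRing R] [IsDomain R] [UniqueFactorizationMonoid R]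
    {a : ι → R} (ha : ∀ p, Irreducible p → ∃ l, ¬ p ∣ a l) {d : R} (hd : d ≠ 0) (u : R)
    (h : ∀ l, d ∣ a l * u) : d ∣ u := by
  induction d using UniqueFactorizationMonoid.induction_on_prime generalizing u with
  | h₁ => exact absurd rfl hd
  | h₂ x hx => exact hx.dvd
  | h₃ d p hd0 hp ih =>
    obtain ⟨l, hl⟩ := ha p hp.irreducible
    obtain ⟨u', rfl⟩ := (hp.dvd_or_dvd ((dvd_mul_right p d).trans (h l))).resolve_left hl
    refine mul_dvd_mul_left p (ih hd0 u' fun l => ?_)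
    have := h l
    rwa [mul_left_comm, mul_dvd_mul_iff_left hp.ne_zero] at this

variable {R : Type*} [CommRing R] [IsDomain R] {n : ℕ} {M : Matrix (Fin (n + 1)) (Fin n) R}

lemma mulVec_injective_of_minor_ne_zero {l : Fin (n + 1)}
    (hl : (M.submatrix l.succAbove id).det ≠ 0) : Function.Injective M.mulVec := by
  intro u v huv
  rw [← sub_eq_zero]
  refine Matrix.eq_zero_of_mulVec_eq_zero hl ?_
  rw [Matrix.mulVec_sub, sub_eq_zero]
  ext b
  exact congrFun huv (l.succAbove b)

lemma sum_minor_mul_mulVec (u : Fin n → R) :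
    ∑ l : Fin (n + 1), (-1) ^ (l : ℕ) * (M.submatrix l.succAbove id).det * M.mulVec u l = 0 := by
  have h : (Matrix.of fun a => (Fin.cons (M.mulVec u a) (M a) : Fin (n + 1) → R)).det = 0 := by
    refine Matrix.exists_mulVec_eq_zero_iff.mp ⟨Fin.cons (-1) u, ?_, ?_⟩
    · exact Function.ne_iff.mpr ⟨0, by simp⟩
    · ext a
      simp [Matrix.mulVec, dotProduct, Fin.sum_univ_succ]
  rw [Matrix.det_succ_column_zero] at h
  rw [← h]
  refine Finset.sum_congr rfl fun l _ => ?_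
  rw [mul_right_comm]
  rfl

/-- The Hilbert–Burch exactness criterion over a unique factorization domain: if the maximal minors
have no common irreducible factor, their syzygies are generated by the columns. -/
lemma exists_mulVec_eq_of_sum_minor_eq_zero [UniqueFactorizationMonoid R]
    (hM : ∀ p, Irreducible p → ∃ l : Fin (n + 1), ¬ p ∣ (M.submatrix l.succAbove id).det)
    {l₀ : Fin (n + 1)} (hl₀ : (M.submatrix l₀.succAbove id).det ≠ 0) {v : Fin (n + 1) → R}
    (hv : ∑ l : Fin (n + 1), (-1) ^ (l : ℕ) * (M.submatrix l.succAbove id).det * v l = 0) :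
    ∃ u, M.mulVec u = v := by
  set N : Matrix (Fin (n + 1)) (Fin (n + 1)) R :=
    Matrix.of fun a => (Fin.cons (v a) (M a) : Fin (n + 1) → R) with hN
  have hdet : N.det = 0 := by
    rw [Matrix.det_succ_column_zero, ← hv]
    refine Finset.sum_congr rfl fun l _ => ?_
    rw [mul_right_comm]
    rfl
  have hadj : ∀ l : Fin (n + 1), N.adjugate 0 l =
      (-1) ^ (l : ℕ) * (M.submatrix l.succAbove id).det := fun l => by
    rw [Matrix.adjugate_fin_succ_eq_det_submatrix, Fin.val_zero, add_zero]
    rfl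
  set a : Fin (n + 1) → R := fun l => N.adjugate 0 l with ha
  set u : Fin (n + 1) → Fin n → R := fun l s => N.adjugate s.succ l with hu
  have hrel : ∀ l, M.mulVec (u l) = -(a l • v) := fun l => by
    ext b
    have h1 := congrFun (congrFun (Matrix.mul_adjugate N) b) l
    rw [hdet, zero_smul, Matrix.mul_apply, Fin.sum_univ_succ, Matrix.zero_apply] at h1
    rw [Pi.neg_apply, Pi.smul_apply, smul_eq_mul, eq_neg_iff_add_eq_zero, ← h1, add_comm, mul_comm]
    rfl
  have hcross : ∀ l l', a l • u l' = a l' • u l := fun l l' => by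
    refine mulVec_injective_of_minor_ne_zero hl₀ ?_
    rw [Matrix.mulVec_smul, Matrix.mulVec_smul, hrel, hrel, smul_neg, smul_neg, smul_comm]
  have ha0 : a l₀ ≠ 0 := by
    rw [ha]; dsimp only
    rw [hadj]
    exact mul_ne_zero (pow_ne_zero _ (neg_ne_zero.mpr one_ne_zero)) hl₀
  have hirr : ∀ p, Irreducible p → ∃ l, ¬ p ∣ a l := fun p hp => by
    obtain ⟨l, hl⟩ := hM p hp
    refine ⟨l, fun h => hl ?_⟩
    rw [ha] at h; dsimp only at h
    rw [hadj] at h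
    exact ((isUnit_one.neg.pow _).dvd_mul_left).mp h
  have hdiv : ∀ s, a l₀ ∣ u l₀ s := fun s =>
    dvd_of_forall_dvd_mul hirr ha0 _ fun l => ⟨u l s, congrFun (hcross l l₀) s⟩
  choose q hq using hdiv
  refine ⟨-q, ?_⟩
  have h1 : u l₀ = a l₀ • q := funext hq
  have h2 := hrel l₀
  rw [h1, Matrix.mulVec_smul, ← smul_neg] at h2
  rw [Matrix.mulVec_neg, smul_right_injective _ ha0 h2, neg_neg]

end HilbertBurch

section Resolution

variable {n : ℕ}

/-- The matrix of the map `f` in the resolution. -/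
noncomputable def syzygyMatrix (n : ℕ) (i : Fin (n + 2) → ℕ) :
    Matrix (Fin (n + 1)) (Fin n) (MvPolynomial (Fin (n + 1)) ℂ) :=
  Matrix.of fun j s => completeHomog (n + 1) ((i j.succ : ℤ) - ((s : ℕ) + 1))

lemma completeHomog_zero (N : ℕ) : completeHomog N 0 = 1 := by
  simp [completeHomog, Finset.Nat.antidiagonalTuple_zero_right]

lemma completeHomog_of_neg (N : ℕ) {d : ℤ} (hd : d < 0) : completeHomog N d = 0 := by
  rw [completeHomog, if_neg (by omega)]

lemma Spoly_succ {i : Fin (n + 2) → ℕ} (hi0 : i 0 = 0) (j : Fin (n + 1)) :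
    Spoly (n + 1) i j.succ = (-1) ^ n * ((Equiv.Perm.sign (Fin.revPerm : Equiv.Perm (Fin n)) : ℤ) :
      MvPolynomial (Fin (n + 1)) ℂ) * ((syzygyMatrix n i).submatrix j.succAbove id).det := by
  rw [Spoly, Matrix.det_succ_row_zero, Finset.sum_eq_single (Fin.last n)]
  · rw [mul_assoc ((-1) ^ n), ← Matrix.det_permute', Fin.val_last, Matrix.of_apply, Fin.succ_succAbove_zero,
      Hmat, Matrix.of_apply, hi0, Fin.val_last]
    have h0 : ((0 : ℕ) : ℤ) - (((n + 1 : ℕ) : ℤ) - 1 - (n : ℕ)) = 0 := by push_cast; ring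
    rw [h0, completeHomog_zero, mul_one]
    congr 2
    ext1 a s
    simp only [Matrix.submatrix_apply, Matrix.of_apply, syzygyMatrix, id, Fin.succAbove_last,
      Fin.succ_succAbove_succ, Fin.revPerm_apply, Fin.val_rev, Fin.val_castSucc]
    congr 2
    have := s.isLt
    omega
  · intro b _ hb
    have hb' : (b : ℕ) < n := Fin.val_lt_last hb
    rw [Matrix.of_apply, Fin.succ_succAbove_zero, Hmat, Matrix.of_apply, hi0,
      completeHomog_of_neg _ (by push_cast; omega)]
    simp
  · intro h; exact absurd (Finset.mem_univ _) h

lemma Spoly_zero_eq {i : Fin (n + 2) → ℕ} (hi0 : i 0 = 0) :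
    Spoly (n + 1) i 0 = -∑ j : Fin (n + 1), (-1) ^ ((j : ℕ) + 1) *
      completeHomog (n + 1) (i j.succ) * Spoly (n + 1) i j.succ := by
  have h : (Matrix.of fun a => (Fin.cons (Hmat (n + 1) i a (Fin.last n)) (Hmat (n + 1) i a) :
      Fin (n + 2) → MvPolynomial (Fin (n + 1)) ℂ)).det = 0 :=
    Matrix.det_zero_of_column_eq (Fin.succ_ne_zero (Fin.last n)).symm fun a => by
      simp only [Matrix.of_apply, Fin.cons_zero, Fin.cons_succ]
  have hH : ∀ a, Hmat (n + 1) i a (Fin.last n) = completeHomog (n + 1) (i a) := fun a => by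
    rw [Hmat, Matrix.of_apply, Fin.val_last]
    congr 1
    push_cast
    ring
  rw [Matrix.det_succ_column_zero, Fin.sum_univ_succ] at h
  simp only [Matrix.of_apply, Fin.cons_zero, hH, hi0, Nat.cast_zero, completeHomog_zero,
    Fin.val_zero, pow_zero, one_mul, Fin.val_succ] at h
  exact eq_neg_of_add_eq_zero_left h

lemma Spoly_zero_mem_span {i : Fin (n + 2) → ℕ} (hi0 : i 0 = 0) :
    Spoly (n + 1) i 0 ∈ Ideal.span (Set.range fun j : Fin (n + 1) => Spoly (n + 1) i j.succ) := by
  rw [Spoly_zero_eq hi0]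
  exact neg_mem (sum_mem fun j _ => Ideal.mul_mem_left _ _ (Ideal.subset_span ⟨j, rfl⟩))

lemma isUnit_neg_one_pow_mul_sign (n : ℕ) (σ : Equiv.Perm (Fin n)) {R : Type*} [CommRing R] :
    IsUnit ((-1) ^ n * ((Equiv.Perm.sign σ : ℤ) : R)) :=
  (isUnit_one.neg.pow n).mul (((Equiv.Perm.sign σ).isUnit).map (Int.castRingHom R))

lemma exists_not_dvd_minor_syzygyMatrix (hn : 1 ≤ n) {i : Fin (n + 2) → ℕ} (hi0 : i 0 = 0)
    (hi : Function.Injective i) (hgcd : Finset.gcd (Finset.Ioi 0) i = 1)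
    {p : MvPolynomial (Fin (n + 1)) ℂ} (hp : Irreducible p) :
    ∃ j : Fin (n + 1), ¬ p ∣ ((syzygyMatrix n i).submatrix j.succAbove id).det := by
  by_contra! h
  have hsucc : ∀ j : Fin (n + 1), p ∣ Spoly (n + 1) i j.succ := fun j => by
    rw [Spoly_succ hi0]
    exact (h j).mul_left _
  obtain ⟨l, hl⟩ := exists_not_dvd_Spoly hn hi0 hi hgcd hp
  refine hl ?_
  induction l using Fin.cases with
  | zero =>
    rw [Spoly_zero_eq hi0]
    exact (Finset.dvd_sum fun j _ => (hsucc j).mul_left _).neg_right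
  | succ j => exact hsucc j

end Resolution

/-- Theorem `th:k*k+1`(ii) (Cohen–Macaulayness via an explicit resolution): for
`I = (0 = i₀ < i₁ < ⋯ < i_k)` with `gcd(i₁,…,i_k) = 1`, the sequence
`0 → R^{k-1} →(f) R^k →(g) R → R/I_I^A → 0` is exact, where
`g(e_j) = (-1)^{k-j} S_j` (`j = 1,…,k`) and `f(ε_s) = (h_{i₁-s}, …, h_{i_k-s})`
(`s = 1,…,k-1`): `f` is injective, `ker g = range f`, and `range g = I_I^A`. -/
theorem vandermonde_resolution_exact (k : ℕ) (hk : 2 ≤ k) (i : Fin (k + 1) → ℕ)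
    (hi0 : i 0 = 0) (hmono : StrictMono i)
    (hgcd : Finset.gcd (Finset.Ioi (0 : Fin (k + 1))) i = 1) :
    let R := MvPolynomial (Fin k) ℂ
    let g : (Fin k → R) →ₗ[R] R :=
      ∑ j : Fin k, LinearMap.smulRight (LinearMap.proj j)
        ((-1 : R) ^ (k - ((j : ℕ) + 1)) * Spoly k i j.succ)
    let f : (Fin (k - 1) → R) →ₗ[R] (Fin k → R) :=
      ∑ s : Fin (k - 1), LinearMap.smulRight (LinearMap.proj s)
        (fun j : Fin k => completeHomog k ((i j.succ : ℤ) - ((s : ℕ) + 1)))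
    Function.Injective f ∧ LinearMap.ker g = LinearMap.range f ∧
      LinearMap.range g = vandermondeIdealA k i := by
  obtain ⟨n, rfl⟩ : ∃ n, k = n + 1 := ⟨k - 1, by omega⟩
  intro R g f
  have hf : ∀ u, f u = (syzygyMatrix n i).mulVec u := fun u => by
    ext1 j
    simp only [f, LinearMap.sum_apply, LinearMap.smulRight_apply, LinearMap.proj_apply,
      Finset.sum_apply, Pi.smul_apply, smul_eq_mul, Matrix.mulVec, dotProduct]
    exact Finset.sum_congr rfl fun s _ => mul_comm _ _
  have hgS : ∀ v, g v = ∑ j : Fin (n + 1), v j * ((-1) ^ (n + 1 - ((j : ℕ) + 1)) *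
      Spoly (n + 1) i j.succ) := fun v => by
    simp only [g, LinearMap.sum_apply, LinearMap.smulRight_apply, LinearMap.proj_apply,
      smul_eq_mul]
  obtain ⟨c, hc, hg⟩ : ∃ c : R, IsUnit c ∧ ∀ v, g v = c * ∑ j : Fin (n + 1), (-1) ^ (j : ℕ) *
      ((syzygyMatrix n i).submatrix j.succAbove id).det * v j := by
    refine ⟨_, (isUnit_one.neg.pow n).mul (isUnit_neg_one_pow_mul_sign n Fin.revPerm), fun v => ?_⟩
    rw [hgS, Finset.mul_sum]
    refine Finset.sum_congr rfl fun j _ => ?_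
    have hpow : (-1 : R) ^ (n + 1 - ((j : ℕ) + 1)) = (-1) ^ n * (-1) ^ (j : ℕ) := by
      obtain ⟨m, hm⟩ := Nat.exists_eq_add_of_le (Nat.lt_succ_iff.mp j.isLt)
      have h1 : n + 1 - ((j : ℕ) + 1) = m := by omega
      have h2 : n + j = m + 2 * j := by omega
      rw [h1, ← pow_add, h2, pow_add, pow_mul, neg_one_sq, one_pow, mul_one]
    rw [hpow, Spoly_succ hi0]
    ring
  have hM : ∀ p : R, Irreducible p →
      ∃ j : Fin (n + 1), ¬ p ∣ ((syzygyMatrix n i).submatrix j.succAbove id).det := fun p hp =>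
    exists_not_dvd_minor_syzygyMatrix (by omega) hi0 hmono.injective hgcd hp
  obtain ⟨j₀, hj₀⟩ := hM (X 0) (X_prime (i := 0)).irreducible
  have hj₀' : ((syzygyMatrix n i).submatrix j₀.succAbove id).det ≠ 0 := fun h =>
    hj₀ (h ▸ dvd_zero _)
  refine ⟨fun u v huv => ?_, ?_, le_antisymm ?_ (Ideal.span_le.mpr ?_)⟩
  · rw [hf, hf] at huv
    exact mulVec_injective_of_minor_ne_zero hj₀' huv
  · ext v
    rw [LinearMap.mem_ker, LinearMap.mem_range, hg, hc.mul_right_eq_zero]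
    constructor
    · intro hv
      obtain ⟨u, hu⟩ := exists_mulVec_eq_of_sum_minor_eq_zero hM hj₀' hv
      exact ⟨u, (hf u).trans hu⟩
    · rintro ⟨u, rfl⟩
      rw [hf]
      exact sum_minor_mul_mulVec u
  · rintro _ ⟨v, rfl⟩
    rw [hgS]
    exact sum_mem fun j _ => Ideal.mul_mem_left _ _ (Ideal.mul_mem_left _ _
      (Ideal.subset_span ⟨j.succ, rfl⟩))
  · have hsucc : Ideal.span (Set.range fun j : Fin (n + 1) => Spoly (n + 1) i j.succ) ≤
        LinearMap.range g := Ideal.span_le.mpr <| by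
      rintro _ ⟨j, rfl⟩
      refine ⟨Pi.single j ((-1) ^ (n + 1 - ((j : ℕ) + 1))), ?_⟩
      rw [hgS, Finset.sum_eq_single j (fun b _ hb => by rw [Pi.single_eq_of_ne hb, zero_mul])
        (fun h => absurd (Finset.mem_univ j) h), Pi.single_eq_same, ← mul_assoc, ← mul_pow,
        neg_one_mul, neg_neg, one_pow, one_mul]
    rintro _ ⟨l, rfl⟩
    induction l using Fin.cases with
    | zero => exact hsucc (Spoly_zero_mem_span hi0)
    | succ j => exact hsucc (Ideal.subset_span ⟨j, rfl⟩)
end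

section
/- Let k ≥ 2, let 0 = i_0 < i_1 < ⋯ < i_k be integers, N = i_1 + ⋯ + i_k, and define the polynomial T(t) = 1 − Σ_{j=1}^{k} t^{N − i_j − k(k−1)/2} + Σ_{j=1}^{k−1} t^{N − j − k(k−1)/2} ∈ ℤ[t]. Then (1−t)^2 divides T(t) in ℚ[t], and the quotient polynomial Q(t) = T(t)/(1−t)^2 satisfies Q(1) = Σ_{1≤j<l≤k} i_j·i_l − binom(k,2)·Σ_{j=1}^{k} i_j + binom(k+1,3)·(3k−2)/4. (This value is the degree of the Vandermonde variety Vd_{k;I}^A.) -/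
open Polynomial in
/-- Second-order Taylor expansion of `X ^ n` at `1`. -/
theorem X_pow_eq_taylor_one (n : ℕ) : ∃ R : ℚ[X],
    (X : ℚ[X]) ^ n = 1 + C (n : ℚ) * (X - 1) + (1 - X) ^ 2 * R ∧
      R.eval 1 = (n : ℚ) * (n - 1) / 2 := by
  induction n with
  | zero => exact ⟨0, by simp⟩
  | succ n ih =>
    obtain ⟨R, h, hR⟩ := ih
    refine ⟨C (n : ℚ) + X * R, ?_, ?_⟩
    · rw [pow_succ, h]
      simp only [Nat.cast_add, Nat.cast_one, map_add, map_one]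
      ring
    · simp only [eval_add, eval_C, eval_mul, eval_X, hR]
      push_cast
      ring

theorem sq_sum_eq_sum_sq_add_sum_Ioi {n : ℕ} (f : Fin n → ℚ) :
    (∑ j, f j) ^ 2 = ∑ j, f j ^ 2 + 2 * ∑ j, ∑ l ∈ Finset.Ioi j, f j * f l := by
  induction n with
  | zero => simp
  | succ n ih =>
    have h := ih (fun j => f j.succ)
    simp only [Fin.sum_univ_succ, Fin.sum_Ioi_zero, Fin.sum_Ioi_succ, ← Finset.mul_sum] at h ⊢
    linear_combination h

theorem val_le_of_strictMono {n : ℕ} {f : Fin (n + 1) → ℕ} (hf : StrictMono f)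
    (x : Fin (n + 1)) : (x : ℕ) ≤ f x := by
  induction x using Fin.induction with
  | zero => simp
  | succ x ih =>
    have h := hf x.castSucc_lt_succ
    simp only [Fin.val_castSucc, Fin.val_succ] at ih ⊢
    omega

theorem choose_two_add_le_sum {k : ℕ} {i : Fin (k + 1) → ℕ} (hmono : StrictMono i)
    (a : ℕ) (ha : a ≤ i (Fin.last k)) : k.choose 2 + a ≤ ∑ j, i j := by
  rw [Fin.sum_univ_castSucc]
  refine add_le_add ?_ ha
  calc k.choose 2 = ∑ x : Fin k, (x : ℕ) := by
        rw [Fin.sum_univ_eq_sum_range (fun x => x), Finset.sum_range_id, Nat.choose_two_right]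
    _ ≤ _ := Finset.sum_le_sum fun x _ => val_le_of_strictMono hmono x.castSucc

theorem cast_choose_three (k : ℕ) :
    ((k + 1).choose 3 : ℚ) = (k + 1) * k * (k - 1) / 6 := by
  induction k with
  | zero => simp [Nat.choose]
  | succ k ih =>
    rw [Nat.choose_succ_succ' (k + 1) 2, Nat.cast_add, ih, Nat.cast_choose_two]
    push_cast
    ring

theorem sum_Icc_cast (n : ℕ) : ∑ j ∈ Finset.Icc 1 n, (j : ℚ) = n * (n + 1) / 2 := by
  induction n with
  | zero => simp
  | succ n ih =>
    rw [Finset.sum_Icc_succ_top (by omega), ih]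
    push_cast
    ring

theorem sum_Icc_cast_sq (n : ℕ) :
    ∑ j ∈ Finset.Icc 1 n, (j : ℚ) ^ 2 = n * (n + 1) * (2 * n + 1) / 6 := by
  induction n with
  | zero => simp
  | succ n ih =>
    rw [Finset.sum_Icc_succ_top (by omega), ih]
    push_cast
    ring


/-- Theorem `th:k*k+1`(iv), as a polynomial identity. Let `2 ≤ k`,
`0 = i₀ < i₁ < ⋯ < i_k`, `N = i₁ + ⋯ + i_k`, and
`T(t) = 1 - ∑_{j=1}^k t^{N - i_j - C(k,2)} + ∑_{j=1}^{k-1} t^{N - j - C(k,2)}`.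
Then `(1-t)²` divides `T` in `ℚ[t]`, and the quotient `Q = T/(1-t)²` satisfies
`Q(1) = ∑_{1 ≤ j < l ≤ k} i_j i_l - C(k,2) ∑_{j=1}^k i_j + C(k+1,3)(3k-2)/4`
(the degree of the Vandermonde variety `Vd_{k;I}^A`). -/
theorem degree_vandermonde_k_kplus1 (k : ℕ) (hk : 2 ≤ k) (i : Fin (k + 1) → ℕ)
    (hi0 : i 0 = 0) (hmono : StrictMono i) :
    let N : ℕ := ∑ j ∈ Finset.Ioi (0 : Fin (k + 1)), i j
    let T : Polynomial ℚ :=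
      1 - ∑ j ∈ Finset.Ioi (0 : Fin (k + 1)), (Polynomial.X : Polynomial ℚ) ^ (N - i j - k.choose 2)
        + ∑ j ∈ Finset.Icc 1 (k - 1), (Polynomial.X : Polynomial ℚ) ^ (N - j - k.choose 2)
    ∃ Q : Polynomial ℚ, T = (1 - Polynomial.X) ^ 2 * Q ∧
      Q.eval 1 = ∑ j ∈ Finset.Ioi (0 : Fin (k + 1)), ∑ l ∈ Finset.Ioi j, (i j : ℚ) * (i l : ℚ)
        - (k.choose 2 : ℚ) * ∑ j ∈ Finset.Ioi (0 : Fin (k + 1)), (i j : ℚ)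
        + ((k + 1).choose 3 : ℚ) * (3 * (k : ℚ) - 2) / 4 := by
  intro N T
  have hN : N = ∑ j, i j := by
    simp only [N, Fin.sum_univ_succ i, Fin.sum_Ioi_zero, hi0, zero_add]
  choose R hR hR1 using X_pow_eq_taylor_one
  have hlast : k ≤ i (Fin.last k) := by
    simpa using val_le_of_strictMono hmono (Fin.last k)
  have ha (j : Fin (k + 1)) :
      ((N - i j - k.choose 2 : ℕ) : ℚ) = N - k.choose 2 - i j := by
    have h := choose_two_add_le_sum hmono (i j) (hmono.monotone (Fin.le_last j))
    rw [Nat.cast_sub (by omega), Nat.cast_sub (by omega)]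
    ring
  have hb (j : ℕ) (hj : j ∈ Finset.Icc 1 (k - 1)) :
      ((N - j - k.choose 2 : ℕ) : ℚ) = N - k.choose 2 - j := by
    rw [Finset.mem_Icc] at hj
    have h := choose_two_add_le_sum hmono j (by omega)
    rw [Nat.cast_sub (by omega), Nat.cast_sub (by omega)]
    ring
  have hcard : ((Finset.Ioi (0 : Fin (k + 1))).card : ℚ) = k := by simp
  have hk1 : ((k - 1 : ℕ) : ℚ) = k - 1 := by
    rw [Nat.cast_sub (by omega), Nat.cast_one]
  have hNQ : ∑ j ∈ Finset.Ioi (0 : Fin (k + 1)), (i j : ℚ) = N := by simp [N]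
  have hc : (k.choose 2 : ℚ) = k * (k - 1) / 2 := Nat.cast_choose_two ℚ k
  have hs1 := sum_Icc_cast (k - 1)
  have hs2 := sum_Icc_cast_sq (k - 1)
  rw [hk1] at hs1 hs2
  have hsq : (N : ℚ) ^ 2 = ∑ j ∈ Finset.Ioi (0 : Fin (k + 1)), (i j : ℚ) ^ 2 +
      2 * ∑ j ∈ Finset.Ioi (0 : Fin (k + 1)), ∑ l ∈ Finset.Ioi j, (i j : ℚ) * (i l : ℚ) := by
    have h := sq_sum_eq_sum_sq_add_sum_Ioi fun j => (i j : ℚ)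
    rw [← hNQ]
    simpa [Fin.sum_univ_succ, Fin.sum_Ioi_zero, hi0] using h
  refine ⟨∑ j ∈ Finset.Icc 1 (k - 1), R (N - j - k.choose 2) -
    ∑ j ∈ Finset.Ioi (0 : Fin (k + 1)), R (N - i j - k.choose 2), ?_, ?_⟩
  · have hA : ∑ j ∈ Finset.Ioi (0 : Fin (k + 1)), ((N - i j - k.choose 2 : ℕ) : ℚ) =
        ∑ j ∈ Finset.Icc 1 (k - 1), ((N - j - k.choose 2 : ℕ) : ℚ) := by
      rw [Finset.sum_congr rfl fun j _ => ha j, Finset.sum_congr rfl hb]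
      simp only [Finset.sum_sub_distrib, Finset.sum_const, nsmul_eq_mul, hcard, hNQ, hs1,
        Nat.card_Icc, Nat.add_sub_cancel, hk1, hc]
      ring
    have hA' := congrArg (Polynomial.C : ℚ → Polynomial ℚ) hA
    have hcard' : ((Finset.Ioi (0 : Fin (k + 1))).card : Polynomial ℚ) = k := by simp
    have hk1' : ((k - 1 : ℕ) : Polynomial ℚ) = k - 1 := by
      rw [Nat.cast_sub (by omega), Nat.cast_one]
    rw [map_sum, map_sum] at hA'
    simp only [T, hR, Finset.sum_add_distrib, ← Finset.sum_mul, ← Finset.mul_sum, hA',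
      Finset.sum_const, nsmul_eq_mul, hcard', Nat.card_Icc, Nat.add_sub_cancel, hk1']
    ring
  · rw [Polynomial.eval_sub, Polynomial.eval_finsetSum, Polynomial.eval_finsetSum]
    have expand (x : ℚ) : ((N : ℚ) - k.choose 2 - x) * (N - k.choose 2 - x - 1) / 2 =
        (N - k.choose 2) * (N - k.choose 2 - 1) / 2 -
          ((N - k.choose 2) - 1 / 2) * x + 1 / 2 * x ^ 2 := by ring
    have hRa (j : Fin (k + 1)) := (hR1 (N - i j - k.choose 2)).trans (by rw [ha j, expand])
    have hRb (j : ℕ) (hj : j ∈ Finset.Icc 1 (k - 1)) :=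
      (hR1 (N - j - k.choose 2)).trans (by rw [hb j hj, expand])
    rw [Finset.sum_congr rfl hRb, Finset.sum_congr rfl fun j _ => hRa j]
    simp only [← Finset.mul_sum] at hsq
    simp only [Finset.sum_add_distrib, Finset.sum_sub_distrib, ← Finset.mul_sum,
      Finset.sum_const, nsmul_eq_mul, hcard, hNQ, hs1, hs2, Nat.card_Icc, Nat.add_sub_cancel,
      hk1, hc, cast_choose_three]
    linear_combination 1 / 2 * hsq
end
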